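/- arXiv:1403.2298 — 3 statements merged into one kernel-verified Lean document; each statement's English description precedes it below -/
import Mathlib

section
/- Let V be a K-vector space with a bounded internal ℤ²-grading V = ⊕_{(p,q)} B^{p,q} and δ₁, δ₂ : V → V of bidegrees (1,0) and (0,1) respectively, with δ₁² = 0, δ₂² = 0 and δ₁δ₂ + δ₂δ₁ = 0. Suppose that every H_{δ₁}^{p,q} and every H_{δ₂}^{p,q} is finite-dimensional. Then for every k ∈ ℤ, either some H_BC^{p,q} or some H_A^{p,q} with p+q=k is infinite-dimensional, or Σ_{p+q=k} ( dim H_BC^{p,q} + dim H_A^{p,q} ) ≥ 2 · dim H_d^k. -/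
open LinearMap Module

/-- The quotient of a subspace `M` of `V` by (the intersection with `M` of) another
subspace `N` of `V`. -/
abbrev SubQuot {K V : Type*} [Field K] [AddCommGroup V] [Module K V]
    (M N : Submodule K V) : Type _ :=
  M ⧸ (N.comap M.subtype)

/-- The total-degree-`k` piece `⊕_{p+q=k} B^{p,q}` of a `ℤ²`-graded vector space. -/
abbrev TotalPiece {K V : Type*} [Field K] [AddCommGroup V] [Module K V]
    (B : ℤ × ℤ → Submodule K V) (k : ℤ) : Submodule K V :=
  ⨆ p : ℤ, B (p, k - p)

section GeneralLinearAlgebra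

variable {K : Type*} [Field K]

/-- A dimension bound from a surjection `π : M → Y` such that the kernel of `g : M → Z` is sent by
`π` into the range of `f : X → Y`. -/
theorem finrank_le_add_of_ker_le {X Y Z M : Type*} [AddCommGroup X] [Module K X]
    [AddCommGroup Y] [Module K Y] [AddCommGroup Z] [Module K Z] [AddCommGroup M] [Module K M]
    [FiniteDimensional K X] [FiniteDimensional K Z]
    (f : X →ₗ[K] Y) (g : M →ₗ[K] Z) (π : M →ₗ[K] Y) (hπ : Function.Surjective π)
    (h : ∀ m, g m = 0 → π m ∈ range f) :
    FiniteDimensional K Y ∧ finrank K Y ≤ finrank K X + finrank K Z := by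
  have hle : ker g ≤ ker ((range f).mkQ ∘ₗ π) := fun m hm => by
    simpa [LinearMap.mem_ker] using h m hm
  have hsurj : Function.Surjective ((ker g).liftQ _ hle) := by
    intro y
    obtain ⟨y, rfl⟩ := (range f).mkQ_surjective y
    obtain ⟨m, rfl⟩ := hπ y
    exact ⟨(ker g).mkQ m, by simp⟩
  have : FiniteDimensional K (M ⧸ ker g) := Module.Finite.equiv g.quotKerEquivRange.symm
  have : FiniteDimensional K (Y ⧸ range f) := Module.Finite.of_surjective _ hsurj
  have hY : FiniteDimensional K Y := Module.Finite.of_submodule_quotient (range f)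
  refine ⟨hY, ?_⟩
  have e1 := Submodule.finrank_quotient_add_finrank (range f)
  have e2 := LinearMap.finrank_le_finrank_of_surjective hsurj
  have e3 := g.quotKerEquivRange.finrank_eq
  have e4 := Submodule.finrank_le (range g)
  have e5 := LinearMap.finrank_range_le f
  omega

variable {V : Type*} [AddCommGroup V] [Module K V]

theorem subsingleton_subQuot_of_eq_bot {M N : Submodule K V} (hM : M = ⊥) :
    Subsingleton (SubQuot M N) := by
  subst hM
  exact (Submodule.mkQ_surjective _).subsingleton

/-- The map of subquotients induced by an inclusion on numerators and denominators. -/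
def SubQuot.mapOfLE {M N M' N' : Submodule K V} (hM : M ≤ M') (hN : N ≤ N') :
    SubQuot M N →ₗ[K] SubQuot M' N' :=
  Submodule.mapQ _ _ (Submodule.inclusion hM) fun _ hx => hN hx

/-- The class of an element in a subquotient. -/
def SubQuot.mk (M N : Submodule K V) : M →ₗ[K] SubQuot M N := Submodule.mkQ _

theorem SubQuot.mk_surjective (M N : Submodule K V) : Function.Surjective (SubQuot.mk M N) :=
  Submodule.mkQ_surjective _

theorem SubQuot.mk_eq_mk {M N : Submodule K V} {x y : M} :
    SubQuot.mk M N x = SubQuot.mk M N y ↔ (x - y : V) ∈ N := by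
  simp [SubQuot.mk, Submodule.Quotient.eq]

theorem SubQuot.mk_eq_zero {M N : Submodule K V} {x : M} :
    SubQuot.mk M N x = 0 ↔ (x : V) ∈ N := by
  simp [SubQuot.mk]

theorem SubQuot.mapOfLE_mk {M N M' N' : Submodule K V} (hM : M ≤ M') (hN : N ≤ N') (x : M) :
    SubQuot.mapOfLE hM hN (SubQuot.mk M N x) = SubQuot.mk M' N' ⟨x, hM x.2⟩ := rfl

end GeneralLinearAlgebra

section Graded

variable {K V ι : Type*} [Field K] [AddCommGroup V] [Module K V]

/-- The image of any vector under a homogeneous map has the same component in a given degree as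
the image of some homogeneous vector. -/
theorem exists_mem_sub_mem_iSup_ne {B : ι → Submodule K V} (htop : ⨆ i, B i = ⊤)
    (δ : V →ₗ[K] V) (e : ι ≃ ι) (hδ : ∀ i, (B i).map δ ≤ B (e i)) (i : ι) (x : V) :
    ∃ x₀ ∈ B i, δ x - δ x₀ ∈ ⨆ j, ⨆ (_ : j ≠ e i), B j := by
  have hx : x ∈ B i ⊔ ⨆ j, ⨆ (_ : j ≠ i), B j := by
    rw [← iSup_split_single, htop]; trivial
  obtain ⟨x₀, h₀, x₁, h₁, rfl⟩ := Submodule.mem_sup.1 hx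
  refine ⟨x₀, h₀, ?_⟩
  have hle : (⨆ j, ⨆ (_ : j ≠ i), B j).map δ ≤ ⨆ j, ⨆ (_ : j ≠ e i), B j := by
    simp only [Submodule.map_iSup]
    exact iSup₂_le fun j hj => (hδ j).trans (le_iSup₂_of_le (e j) (e.injective.ne hj) le_rfl)
  simpa using hle (Submodule.mem_map_of_mem h₁)

end Graded

section DoubleComplex

variable {K V : Type*} [Field K] [AddCommGroup V] [Module K V]
  {B : ℤ × ℤ → Submodule K V} {δ₁ δ₂ : V →ₗ[K] V}

theorem exists_left_mem_sub_mem_iSup_ne (htop : ⨆ i, B i = ⊤)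
    (hd1 : ∀ p q : ℤ, (B (p, q)).map δ₁ ≤ B (p + 1, q)) (p q : ℤ) (x : V) :
    ∃ x₀ ∈ B (p - 1, q), δ₁ x - δ₁ x₀ ∈ ⨆ j, ⨆ (_ : j ≠ (p, q)), B j := by
  simpa using exists_mem_sub_mem_iSup_ne htop δ₁ (Equiv.addRight ((1, 0) : ℤ × ℤ))
    (fun i => by simpa [Prod.add_def] using hd1 i.1 i.2) (p - 1, q) x

theorem exists_right_mem_sub_mem_iSup_ne (htop : ⨆ i, B i = ⊤)
    (hd2 : ∀ p q : ℤ, (B (p, q)).map δ₂ ≤ B (p, q + 1)) (p q : ℤ) (x : V) :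
    ∃ x₀ ∈ B (p, q - 1), δ₂ x - δ₂ x₀ ∈ ⨆ j, ⨆ (_ : j ≠ (p, q)), B j := by
  simpa using exists_mem_sub_mem_iSup_ne htop δ₂ (Equiv.addRight ((0, 1) : ℤ × ℤ))
    (fun i => by simpa [Prod.add_def] using hd2 i.1 i.2) (p, q - 1) x

/-- In each bidegree, the dimensions of the row and column cohomologies add up to at most
the sum of the dimensions of Bott–Chern and Aeppli cohomology. -/
theorem finrank_row_add_finrank_column_le (hind : iSupIndep B) (htop : ⨆ i, B i = ⊤)
    (hd1 : ∀ p q : ℤ, (B (p, q)).map δ₁ ≤ B (p + 1, q))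
    (hd2 : ∀ p q : ℤ, (B (p, q)).map δ₂ ≤ B (p, q + 1))
    (h1 : δ₁ ∘ₗ δ₁ = 0) (h2 : δ₂ ∘ₗ δ₂ = 0) (h12 : δ₁ ∘ₗ δ₂ + δ₂ ∘ₗ δ₁ = 0) (p q : ℤ)
    [FiniteDimensional K (SubQuot (ker δ₁ ⊓ B (p, q)) (range δ₁))]
    [FiniteDimensional K (SubQuot (ker δ₂ ⊓ B (p, q)) (range δ₂))]
    [FiniteDimensional K (SubQuot (ker δ₁ ⊓ ker δ₂ ⊓ B (p, q)) (range (δ₁ ∘ₗ δ₂)))]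
    [FiniteDimensional K (SubQuot (ker (δ₁ ∘ₗ δ₂) ⊓ B (p, q)) (range δ₁ ⊔ range δ₂))] :
    finrank K (SubQuot (ker δ₁ ⊓ B (p, q)) (range δ₁)) +
      finrank K (SubQuot (ker δ₂ ⊓ B (p, q)) (range δ₂)) ≤
    finrank K (SubQuot (ker δ₁ ⊓ ker δ₂ ⊓ B (p, q)) (range (δ₁ ∘ₗ δ₂))) +
      finrank K (SubQuot (ker (δ₁ ∘ₗ δ₂) ⊓ B (p, q)) (range δ₁ ⊔ range δ₂)) := by
  have e1 : ∀ x, δ₁ (δ₁ x) = 0 := fun x => LinearMap.congr_fun h1 x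
  have e2 : ∀ x, δ₂ (δ₂ x) = 0 := fun x => LinearMap.congr_fun h2 x
  have e12 : ∀ x, δ₁ (δ₂ x) = - δ₂ (δ₁ x) := fun x =>
    eq_neg_of_add_eq_zero_left (LinearMap.congr_fun h12 x)
  have l1 : ker δ₁ ⊓ B (p, q) ≤ ker (δ₁ ∘ₗ δ₂) ⊓ B (p, q) :=
    inf_le_inf_right _ fun x hx => by
      rw [LinearMap.mem_ker] at hx
      simp [e12, hx]
  have l2 : ker δ₂ ⊓ B (p, q) ≤ ker (δ₁ ∘ₗ δ₂) ⊓ B (p, q) :=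
    inf_le_inf_right _ fun x hx => by
      rw [LinearMap.mem_ker] at hx
      simp [hx]
  have r1 : range (δ₁ ∘ₗ δ₂) ≤ range δ₁ := LinearMap.range_comp_le_range _ _
  have r2 : range (δ₁ ∘ₗ δ₂) ≤ range δ₂ := by
    rintro _ ⟨x, rfl⟩
    exact ⟨- δ₁ x, by simp [e12]⟩
  rw [← Module.finrank_prod]
  refine (finrank_le_add_of_ker_le
    ((SubQuot.mapOfLE (inf_le_inf_right _ inf_le_left) r1).prod
      (-SubQuot.mapOfLE (inf_le_inf_right _ inf_le_right) r2))
    ((SubQuot.mapOfLE l1 le_sup_left).coprod (SubQuot.mapOfLE l2 le_sup_right))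
    LinearMap.id Function.surjective_id ?_).2
  rintro ⟨a, b⟩ hab
  obtain ⟨⟨a, ha⟩, rfl⟩ := SubQuot.mk_surjective _ _ a
  obtain ⟨⟨b, hb⟩, rfl⟩ := SubQuot.mk_surjective _ _ b
  rw [LinearMap.coprod_apply, SubQuot.mapOfLE_mk, SubQuot.mapOfLE_mk, ← map_add,
    SubQuot.mk_eq_zero] at hab
  obtain ⟨_, ⟨x, rfl⟩, _, ⟨y, rfl⟩, hxy⟩ := Submodule.mem_sup.1 hab
  simp only [Submodule.coe_add] at hxy
  obtain ⟨x₀, hx₀, hx⟩ := exists_left_mem_sub_mem_iSup_ne htop hd1 p q x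
  obtain ⟨y₀, hy₀, hy⟩ := exists_right_mem_sub_mem_iSup_ne htop hd2 p q y
  have hx₀' : δ₁ x₀ ∈ B (p, q) := by simpa using hd1 _ _ (Submodule.mem_map_of_mem hx₀)
  have hy₀' : δ₂ y₀ ∈ B (p, q) := by simpa using hd2 _ _ (Submodule.mem_map_of_mem hy₀)
  have hab₀ : a + b - δ₁ x₀ - δ₂ y₀ = 0 := by
    refine Submodule.disjoint_def.1 (hind (p, q)) _
      (sub_mem (sub_mem (add_mem ha.2 hb.2) hx₀') hy₀') ?_
    convert add_mem hx hy using 1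
    rw [← hxy]
    abel
  have hc : a - δ₁ x₀ = -(b - δ₂ y₀) := by
    rw [← sub_eq_zero, ← hab₀]
    abel
  have ha1 : δ₁ a = 0 := ha.1
  have hb2 : δ₂ b = 0 := hb.1
  have hmem : a - δ₁ x₀ ∈ ker δ₁ ⊓ ker δ₂ ⊓ B (p, q) :=
    ⟨⟨by simp [ha1, e1], by rw [hc]; simp [hb2, e2]⟩, sub_mem ha.2 hx₀'⟩
  refine ⟨SubQuot.mk _ _ ⟨_, hmem⟩, ?_⟩
  rw [LinearMap.prod_apply, Function.prod_apply, LinearMap.neg_apply, SubQuot.mapOfLE_mk,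
    SubQuot.mapOfLE_mk, ← map_neg]
  refine Prod.ext (SubQuot.mk_eq_mk.2 ⟨-x₀, by simp⟩) (SubQuot.mk_eq_mk.2 ⟨-y₀, ?_⟩)
  simp only [map_neg, NegMemClass.coe_neg, hc]
  abel

/-- The column filtration `⊕_{r ≥ n} B^{r,k-r}` on the total-degree-`k` piece. -/
def columnFiltration (B : ℤ × ℤ → Submodule K V) (k n : ℤ) : Submodule K V :=
  ⨆ r : ℤ, ⨆ (_ : n ≤ r), B (r, k - r)

theorem columnFiltration_eq_sup (B : ℤ × ℤ → Submodule K V) (k n : ℤ) :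
    columnFiltration B k n = B (n, k - n) ⊔ columnFiltration B k (n + 1) := by
  apply le_antisymm
  · refine iSup₂_le fun r hr => ?_
    rcases hr.eq_or_lt with rfl | hr
    · exact le_sup_left
    · exact le_sup_of_le_right (le_iSup₂_of_le r hr le_rfl)
  · exact sup_le (le_iSup₂_of_le n le_rfl le_rfl)
      (iSup₂_le fun r hr => le_iSup₂_of_le r (by omega) le_rfl)

theorem map_columnFiltration_le
    (hd1 : ∀ p q : ℤ, (B (p, q)).map δ₁ ≤ B (p + 1, q))
    (hd2 : ∀ p q : ℤ, (B (p, q)).map δ₂ ≤ B (p, q + 1)) (k n : ℤ) :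
    (columnFiltration B k n).map (δ₁ + δ₂) ≤ columnFiltration B (k + 1) n := by
  simp only [columnFiltration, Submodule.map_iSup]
  refine iSup₂_le fun r hr => ?_
  rintro _ ⟨x, hx, rfl⟩
  refine add_mem ?_ ?_
  · refine Submodule.mem_iSup_of_mem (r + 1) (Submodule.mem_iSup_of_mem (by omega) ?_)
    convert hd1 _ _ (Submodule.mem_map_of_mem hx) using 3
    ring
  · refine Submodule.mem_iSup_of_mem r (Submodule.mem_iSup_of_mem hr ?_)
    convert hd2 _ _ (Submodule.mem_map_of_mem hx) using 3
    ring

theorem disjoint_columnFiltration_succ (hind : iSupIndep B) (k n : ℤ) :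
    Disjoint (B (n, k - n)) (columnFiltration B k (n + 1)) :=
  (hind (n, k - n)).mono_right <| iSup₂_le fun r hr =>
    le_iSup₂_of_le (r, k - r) (fun h => by simp only [Prod.mk.injEq] at h; omega) le_rfl

theorem finrank_columnFiltration_le (hind : iSupIndep B) (htop : ⨆ i, B i = ⊤)
    (hd1 : ∀ p q : ℤ, (B (p, q)).map δ₁ ≤ B (p + 1, q))
    (hd2 : ∀ p q : ℤ, (B (p, q)).map δ₂ ≤ B (p, q + 1))
    (h1 : δ₁ ∘ₗ δ₁ = 0) (h2 : δ₂ ∘ₗ δ₂ = 0) (h12 : δ₁ ∘ₗ δ₂ + δ₂ ∘ₗ δ₁ = 0) (k n : ℤ)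
    [FiniteDimensional K (SubQuot (ker δ₂ ⊓ B (n, k - n)) (range δ₂))]
    [FiniteDimensional K
      (SubQuot (ker (δ₁ + δ₂) ⊓ columnFiltration B k (n + 1)) (range (δ₁ + δ₂)))] :
    FiniteDimensional K
      (SubQuot (ker (δ₁ + δ₂) ⊓ columnFiltration B k n) (range (δ₁ + δ₂))) ∧
    finrank K (SubQuot (ker (δ₁ + δ₂) ⊓ columnFiltration B k n) (range (δ₁ + δ₂))) ≤
      finrank K (SubQuot (ker (δ₁ + δ₂) ⊓ columnFiltration B k (n + 1)) (range (δ₁ + δ₂))) +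
      finrank K (SubQuot (ker δ₂ ⊓ B (n, k - n)) (range δ₂)) := by
  have hdd : ∀ x, (δ₁ + δ₂) ((δ₁ + δ₂) x) = 0 := fun x => by
    have e1 : δ₁ (δ₁ x) = 0 := LinearMap.congr_fun h1 x
    have e2 : δ₂ (δ₂ x) = 0 := LinearMap.congr_fun h2 x
    have e12 : δ₁ (δ₂ x) + δ₂ (δ₁ x) = 0 := LinearMap.congr_fun h12 x
    simp only [LinearMap.add_apply, map_add, e1, e2, zero_add, add_zero]
    rw [add_comm, ← e12, add_comm]
  have hF : columnFiltration B k (n + 1) ≤ columnFiltration B k n := by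
    rw [columnFiltration_eq_sup B k n]
    exact le_sup_right
  have hBF : B (n, k - n) ≤ columnFiltration B k n := by
    rw [columnFiltration_eq_sup B k n]
    exact le_sup_left
  let s : ↥(ker δ₂ ⊓ B (n, k - n)) × ↥(columnFiltration B k (n + 1)) →ₗ[K] V :=
    (Submodule.subtype _).coprod (Submodule.subtype _)
  let M := ker ((δ₁ + δ₂) ∘ₗ s)
  have hs : ∀ m : M, (s ∘ₗ M.subtype) m ∈ ker (δ₁ + δ₂) ⊓ columnFiltration B k n := fun m =>
    ⟨m.2, add_mem (hBF m.1.1.2.2) (hF m.1.2.2)⟩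
  refine finrank_le_add_of_ker_le (SubQuot.mapOfLE (inf_le_inf_left _ hF) le_rfl)
    (SubQuot.mk _ _ ∘ₗ LinearMap.fst K _ _ ∘ₗ M.subtype)
    (SubQuot.mk _ _ ∘ₗ (s ∘ₗ M.subtype).codRestrict _ hs) ?_ ?_
  · refine (SubQuot.mk_surjective _ _).comp ?_
    rintro ⟨x, hx, hxF⟩
    rw [columnFiltration_eq_sup] at hxF
    obtain ⟨b, hb, c, hc, rfl⟩ := Submodule.mem_sup.1 hxF
    have hb1 := hd1 _ _ (Submodule.mem_map_of_mem hb)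
    have hb2 := hd2 _ _ (Submodule.mem_map_of_mem hb)
    have hcd := map_columnFiltration_le hd1 hd2 k (n + 1) (Submodule.mem_map_of_mem hc)
    have hk : k - n + 1 = k + 1 - n := by ring
    have hk' : k - n = k + 1 - (n + 1) := by ring
    have hsum : δ₂ b = -(δ₁ b + (δ₁ + δ₂) c) := by
      have hx' : (δ₁ + δ₂) (b + c) = 0 := hx
      rw [map_add, LinearMap.add_apply] at hx'
      rw [← sub_eq_zero, ← hx']
      abel
    have hb0 : δ₂ b = 0 := by
      refine Submodule.disjoint_def.1 (disjoint_columnFiltration_succ hind (k + 1) n) _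
        (hk ▸ hb2) ?_
      rw [hsum]
      refine neg_mem (add_mem ?_ hcd)
      rw [hk'] at hb1
      exact Submodule.mem_iSup_of_mem (n + 1) (Submodule.mem_iSup_of_mem le_rfl hb1)
    exact ⟨⟨(⟨b, hb0, hb⟩, ⟨c, hc⟩), hx⟩, rfl⟩
  · rintro ⟨⟨⟨b, hb0, hb⟩, ⟨c, hc⟩⟩, hm⟩ hg
    obtain ⟨y, rfl⟩ := SubQuot.mk_eq_zero.1 hg
    obtain ⟨y₀, hy₀, hy⟩ := exists_right_mem_sub_mem_iSup_ne htop hd2 n (k - n) y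
    have hy₀' : δ₂ y₀ ∈ B (n, k - n) := by simpa using hd2 _ _ (Submodule.mem_map_of_mem hy₀)
    have hyy : δ₂ y = δ₂ y₀ := sub_eq_zero.1 <|
      Submodule.disjoint_def.1 (hind (n, k - n)) _ (sub_mem hb hy₀') hy
    have hy₁ : δ₁ y₀ ∈ columnFiltration B k (n + 1) := by
      refine Submodule.mem_iSup_of_mem (n + 1) (Submodule.mem_iSup_of_mem le_rfl ?_)
      convert hd1 _ _ (Submodule.mem_map_of_mem hy₀) using 3
      ring
    have hm' : (δ₁ + δ₂) (δ₂ y + c) = 0 := hm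
    have hcy : c - δ₁ y₀ = δ₂ y + c - (δ₁ + δ₂) y₀ := by
      rw [hyy, LinearMap.add_apply]
      abel
    have hmem : c - δ₁ y₀ ∈ ker (δ₁ + δ₂) ⊓ columnFiltration B k (n + 1) := by
      refine ⟨LinearMap.mem_ker.2 ?_, sub_mem hc hy₁⟩
      rw [hcy, map_sub, hm', hdd, sub_zero]
    refine ⟨SubQuot.mk _ _ ⟨_, hmem⟩, ?_⟩
    rw [SubQuot.mapOfLE_mk]
    refine SubQuot.mk_eq_mk.2 ⟨-y₀, ?_⟩
    change _ = c - δ₁ y₀ - (δ₂ y + c)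
    rw [hcy, map_neg]
    abel

theorem finite_setOf_antidiagonal_ne_bot (hbounded : {pq : ℤ × ℤ | B pq ≠ ⊥}.Finite) (k : ℤ) :
    {p : ℤ | B (p, k - p) ≠ ⊥}.Finite :=
  hbounded.preimage (f := fun p : ℤ => (p, k - p)) fun _ _ _ _ h => congrArg Prod.fst h

/-- The Frölicher inequality. -/
theorem finrank_total_le_finsum_finrank_column (hind : iSupIndep B) (htop : ⨆ i, B i = ⊤)
    (hbounded : {pq : ℤ × ℤ | B pq ≠ ⊥}.Finite)
    (hd1 : ∀ p q : ℤ, (B (p, q)).map δ₁ ≤ B (p + 1, q))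
    (hd2 : ∀ p q : ℤ, (B (p, q)).map δ₂ ≤ B (p, q + 1))
    (h1 : δ₁ ∘ₗ δ₁ = 0) (h2 : δ₂ ∘ₗ δ₂ = 0) (h12 : δ₁ ∘ₗ δ₂ + δ₂ ∘ₗ δ₁ = 0)
    (hfin2 : ∀ p q : ℤ, FiniteDimensional K (SubQuot (ker δ₂ ⊓ B (p, q)) (range δ₂))) (k : ℤ) :
    finrank K (SubQuot (ker (δ₁ + δ₂) ⊓ TotalPiece B k) (range (δ₁ + δ₂))) ≤
      ∑ᶠ p : ℤ, finrank K (SubQuot (ker δ₂ ⊓ B (p, k - p)) (range δ₂)) := by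
  have hS := finite_setOf_antidiagonal_ne_bot hbounded k
  obtain ⟨b, hb⟩ := hS.bddAbove
  obtain ⟨a, ha⟩ := hS.bddBelow
  have hbot : ∀ p, p ∉ Finset.Ico a (b + 1) → B (p, k - p) = ⊥ := fun p hp => by
    by_contra h
    exact hp (Finset.mem_Ico.2 ⟨ha h, Int.lt_add_one_of_le (hb h)⟩)
  have key : ∀ m : ℕ,
      FiniteDimensional K (SubQuot (ker (δ₁ + δ₂) ⊓ columnFiltration B k (b + 1 - m))
        (range (δ₁ + δ₂))) ∧
      finrank K (SubQuot (ker (δ₁ + δ₂) ⊓ columnFiltration B k (b + 1 - m))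
        (range (δ₁ + δ₂))) ≤
      ∑ p ∈ Finset.Ico (b + 1 - m) (b + 1),
        finrank K (SubQuot (ker δ₂ ⊓ B (p, k - p)) (range δ₂)) := by
    intro m
    induction m with
    | zero =>
      have h0 : columnFiltration B k (b + 1 - (0 : ℕ)) = ⊥ := by
        refine iSup₂_eq_bot.2 fun r hr => hbot r fun h => ?_
        have := (Finset.mem_Ico.1 h).2
        simp at hr
        omega
      have := subsingleton_subQuot_of_eq_bot (N := range (δ₁ + δ₂))
        (show ker (δ₁ + δ₂) ⊓ columnFiltration B k (b + 1 - (0 : ℕ)) = ⊥ by rw [h0, inf_bot_eq])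
      exact ⟨inferInstance, by rw [finrank_zero_of_subsingleton]; exact Nat.zero_le _⟩
    | succ m ih =>
      have hn : b + 1 - ((m + 1 : ℕ) : ℤ) + 1 = b + 1 - m := by push_cast; ring
      have := hfin2 (b + 1 - ((m + 1 : ℕ) : ℤ)) (k - (b + 1 - ((m + 1 : ℕ) : ℤ)))
      have := ih.1
      rw [← hn] at this
      have step := finrank_columnFiltration_le hind htop hd1 hd2 h1 h2 h12 k
        (b + 1 - ((m + 1 : ℕ) : ℤ))
      rw [hn] at step
      refine ⟨step.1, step.2.trans ?_⟩
      rw [← Finset.sum_Ioo_add_eq_sum_Ico (by push_cast; omega)]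
      refine Nat.add_le_add_right (ih.2.trans_eq (Finset.sum_congr ?_ fun _ _ => rfl)) _
      ext p
      simp only [Finset.mem_Ico, Finset.mem_Ioo]
      push_cast
      omega
  have hT : TotalPiece B k ≤ columnFiltration B k (b + 1 - (b + 1 - a).toNat) := by
    refine iSup_le fun p => ?_
    by_cases hp : p ∈ Finset.Ico a (b + 1)
    · refine le_iSup₂_of_le p ?_ le_rfl
      have := Finset.mem_Ico.1 hp
      omega
    · simp [hbot p hp]
  have hT' : TotalPiece B k = columnFiltration B k (b + 1 - (b + 1 - a).toNat) :=
    le_antisymm hT (iSup₂_le fun r _ => le_iSup (fun p => B (p, k - p)) r)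
  rw [hT']
  refine (key _).2.trans_eq (finsum_eq_sum_of_support_subset _ fun p hp => ?_).symm
  by_contra h
  refine hp ?_
  have := subsingleton_subQuot_of_eq_bot (N := range δ₂)
    (show ker δ₂ ⊓ B (p, k - p) = ⊥ by
      rw [hbot p fun hp' => h ?_, inf_bot_eq]
      have := Finset.mem_Ico.1 hp'
      simp only [Finset.coe_Ico, Set.mem_Ico]
      omega)
  exact finrank_zero_of_subsingleton

theorem finrank_total_le_finsum_finrank_row (hind : iSupIndep B) (htop : ⨆ i, B i = ⊤)
    (hbounded : {pq : ℤ × ℤ | B pq ≠ ⊥}.Finite)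
    (hd1 : ∀ p q : ℤ, (B (p, q)).map δ₁ ≤ B (p + 1, q))
    (hd2 : ∀ p q : ℤ, (B (p, q)).map δ₂ ≤ B (p, q + 1))
    (h1 : δ₁ ∘ₗ δ₁ = 0) (h2 : δ₂ ∘ₗ δ₂ = 0) (h12 : δ₁ ∘ₗ δ₂ + δ₂ ∘ₗ δ₁ = 0)
    (hfin1 : ∀ p q : ℤ, FiniteDimensional K (SubQuot (ker δ₁ ⊓ B (p, q)) (range δ₁))) (k : ℤ) :
    finrank K (SubQuot (ker (δ₁ + δ₂) ⊓ TotalPiece B k) (range (δ₁ + δ₂))) ≤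
      ∑ᶠ p : ℤ, finrank K (SubQuot (ker δ₁ ⊓ B (p, k - p)) (range δ₁)) := by
  have hT : TotalPiece (B ∘ Prod.swap) k = TotalPiece B k := by
    refine (Equiv.iSup_congr (Equiv.subLeft k) fun p => ?_)
    simp
  have h := finrank_total_le_finsum_finrank_column (B := B ∘ Prod.swap) (δ₁ := δ₂) (δ₂ := δ₁)
    (hind.comp Prod.swap_injective)
    (by rw [← htop]; exact (Equiv.prodComm ℤ ℤ).iSup_comp (g := B))
    (hbounded.preimage Prod.swap_injective.injOn)
    (fun p q => hd2 q p) (fun p q => hd1 q p) h2 h1 (by rw [add_comm, h12])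
    (fun p q => hfin1 q p) k
  rw [hT, add_comm δ₂ δ₁] at h
  refine h.trans_eq ?_
  rw [← finsum_comp_equiv (Equiv.subLeft k)]
  refine finsum_congr fun p => ?_
  change finrank K (SubQuot (ker δ₁ ⊓ B (k - (k - p), k - p)) (range δ₁)) = _
  rw [sub_sub_cancel]

end DoubleComplex

theorem frolicher_inequality_BC_A
    {K V : Type*} [Field K] [AddCommGroup V] [Module K V]
    (B : ℤ × ℤ → Submodule K V) (hB : DirectSum.IsInternal B)
    (hbounded : {pq : ℤ × ℤ | B pq ≠ ⊥}.Finite)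
    (δ₁ δ₂ : V →ₗ[K] V)
    (hd1 : ∀ p q : ℤ, (B (p, q)).map δ₁ ≤ B (p + 1, q))
    (hd2 : ∀ p q : ℤ, (B (p, q)).map δ₂ ≤ B (p, q + 1))
    (h1 : δ₁ ∘ₗ δ₁ = 0) (h2 : δ₂ ∘ₗ δ₂ = 0)
    (h12 : δ₁ ∘ₗ δ₂ + δ₂ ∘ₗ δ₁ = 0)
    (hfin1 : ∀ p q : ℤ, FiniteDimensional K (SubQuot (ker δ₁ ⊓ B (p, q)) (range δ₁)))
    (hfin2 : ∀ p q : ℤ, FiniteDimensional K (SubQuot (ker δ₂ ⊓ B (p, q)) (range δ₂))) :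
    ∀ k : ℤ,
      (∃ p q : ℤ, p + q = k ∧
        (¬ FiniteDimensional K
            (SubQuot (ker δ₁ ⊓ ker δ₂ ⊓ B (p, q)) (range (δ₁ ∘ₗ δ₂))) ∨
         ¬ FiniteDimensional K
            (SubQuot (ker (δ₁ ∘ₗ δ₂) ⊓ B (p, q)) (range δ₁ ⊔ range δ₂)))) ∨
      2 * finrank K (SubQuot (ker (δ₁ + δ₂) ⊓ TotalPiece B k) (range (δ₁ + δ₂))) ≤
        ∑ᶠ p : ℤ,
          (finrank K (SubQuot (ker δ₁ ⊓ ker δ₂ ⊓ B (p, k - p)) (range (δ₁ ∘ₗ δ₂))) +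
           finrank K (SubQuot (ker (δ₁ ∘ₗ δ₂) ⊓ B (p, k - p)) (range δ₁ ⊔ range δ₂))) := by
  intro k
  rw [or_iff_not_imp_left]
  intro hinf
  push Not at hinf
  obtain ⟨hind, htop⟩ :=
    (DirectSum.isInternal_submodule_iff_iSupIndep_and_iSup_eq_top B).1 hB
  have hS := finite_setOf_antidiagonal_ne_bot hbounded k
  have hsupp : ∀ X Y : Submodule K V, (Function.support fun p : ℤ =>
      finrank K (SubQuot (X ⊓ B (p, k - p)) Y)).Finite := fun X Y =>
    hS.subset fun p hp hbot => hp <| by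
      have := subsingleton_subQuot_of_eq_bot (N := Y)
        (show X ⊓ B (p, k - p) = ⊥ by rw [hbot, inf_bot_eq])
      exact finrank_zero_of_subsingleton
  have hrow := finrank_total_le_finsum_finrank_row hind htop hbounded hd1 hd2 h1 h2 h12 hfin1 k
  have hcol := finrank_total_le_finsum_finrank_column hind htop hbounded hd1 hd2 h1 h2 h12 hfin2 k
  rw [two_mul]
  refine (Nat.add_le_add hrow hcol).trans ?_
  rw [← finsum_add_distrib (hsupp _ _) (hsupp _ _)]
  refine finsum_le_finsum' (((hsupp _ _).union (hsupp _ _)).subset (Function.support_add _ _))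
    (((hsupp _ _).union (hsupp _ _)).subset (Function.support_add _ _)) fun p => ?_
  obtain ⟨hBC, hA⟩ := hinf p (k - p) (by ring)
  have := hfin1 p (k - p)
  have := hfin2 p (k - p)
  exact finrank_row_add_finrank_column_le hind htop hd1 hd2 h1 h2 h12 p (k - p)
end

section
/- Let V be a K-vector space with a bounded internal ℤ²-grading V = ⊕_{(p,q)} B^{p,q} and δ₁, δ₂ : V → V of bidegrees (1,0) and (0,1) respectively, with δ₁² = 0, δ₂² = 0 and δ₁δ₂ + δ₂δ₁ = 0. Suppose that every H_{δ₁}^{p,q} and every H_{δ₂}^{p,q} is finite-dimensional. Then the following are equivalent: (1) the δ₁δ₂-Lemma holds, i.e. ker δ₁ ∩ ker δ₂ ∩ (im δ₁ + im δ₂) = im(δ₁δ₂); (2) every H_BC^{p,q} and every H_A^{p,q} is finite-dimensional and for every k ∈ ℤ one has Σ_{p+q=k} ( dim H_BC^{p,q} + dim H_A^{p,q} ) = 2 · dim H_d^k. -/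
open LinearMap Module

section RelLength

variable {K V : Type*} [Field K] [AddCommGroup V] [Module K V]

/-- The length (i.e. dimension) of `M / (M ∩ N)`, as an extended natural number. -/
noncomputable def relLength (M N : Submodule K V) : ℕ∞ :=
  Module.length K (M.map N.mkQ)

theorem length_subQuot (M N : Submodule K V) :
    Module.length K (SubQuot M N) = relLength M N := by
  have hk : ker (N.mkQ ∘ₗ M.subtype) = N.comap M.subtype := by
    rw [ker_comp, Submodule.ker_mkQ]
  have hr : range (N.mkQ ∘ₗ M.subtype) = M.map N.mkQ := by
    rw [range_comp, Submodule.range_subtype]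
  unfold relLength
  rw [← hr]
  exact ((Submodule.quotEquivOfEq _ _ hk.symm).trans (quotKerEquivRange _)).length_eq

theorem relLength_ne_top_iff (M N : Submodule K V) :
    relLength M N ≠ ⊤ ↔ FiniteDimensional K (SubQuot M N) := by
  rw [← length_subQuot, Module.length_ne_top_iff, isFiniteLength_iff_isNoetherian_isArtinian]
  refine ⟨fun h ↦ ?_, fun h ↦ ?_⟩
  · have := h.1
    infer_instance
  · exact ⟨inferInstance, inferInstance⟩

theorem relLength_eq_finrank (M N : Submodule K V) [FiniteDimensional K (SubQuot M N)] :
    relLength M N = finrank K (SubQuot M N) := by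
  rw [← length_subQuot, Module.length_eq_finrank]

theorem le_of_relLength_eq_zero {M N : Submodule K V} (h : relLength M N = 0) : M ≤ N := by
  rw [relLength, Module.length_eq_zero_iff, Submodule.subsingleton_iff_eq_bot] at h
  intro x hx
  have : N.mkQ x ∈ M.map N.mkQ := Submodule.mem_map_of_mem hx
  rw [h] at this
  simpa using this

theorem relLength_bot_left (N : Submodule K V) : relLength ⊥ N = 0 := by
  rw [relLength, Submodule.map_bot, Module.length_bot]

theorem relLength_sup_of_le {M C N : Submodule K V} (h : C ≤ N) :
    relLength (M ⊔ C) N = relLength M N := by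
  have : C.map N.mkQ = ⊥ := by
    rw [eq_bot_iff, Submodule.map_le_iff_le_comap]
    exact h.trans (by simp)
  rw [relLength, Submodule.map_sup, this, sup_bot_eq, relLength]

/-- A linear map that sends `M` into `M'` and detects membership in `N` by membership in `N'`
bounds the relative length. -/
theorem relLength_le_of_map {M N M' N' : Submodule K V} (f : V →ₗ[K] V)
    (hM : ∀ x ∈ M, f x ∈ M') (hN : ∀ x ∈ M, f x ∈ N' → x ∈ N) :
    relLength M N ≤ relLength M' N' := by
  let g : M →ₗ[K] SubQuot M' N' :=
    (N'.comap M'.subtype).mkQ ∘ₗ (f.restrict hM)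
  have hg : ker g ≤ N.comap M.subtype := by
    intro x hx
    have : f x ∈ N' := by simpa [g] using hx
    exact hN x x.2 this
  rw [← length_subQuot, ← length_subQuot]
  calc Module.length K (SubQuot M N)
      ≤ Module.length K (M ⧸ ker g) :=
        Module.length_le_of_surjective (Submodule.factor hg) (Submodule.factor_surjective hg)
    _ = Module.length K (range g) := (quotKerEquivRange g).length_eq
    _ ≤ Module.length K (SubQuot M' N') :=
        Module.length_le_of_injective _ (Submodule.subtype_injective _)

theorem relLength_congr_right {M N N' : Submodule K V} (h : M ⊓ N = M ⊓ N') :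
    relLength M N = relLength M N' := by
  apply le_antisymm
  · exact relLength_le_of_map .id (fun x hx ↦ hx)
      fun x hx hx' ↦ (h.ge (⟨hx, hx'⟩ : x ∈ M ⊓ N')).2
  · exact relLength_le_of_map .id (fun x hx ↦ hx)
      fun x hx hx' ↦ (h.le (⟨hx, hx'⟩ : x ∈ M ⊓ N)).2

theorem relLength_eq_add {L N : Submodule K V} (M : Submodule K V) (h : L ≤ N) :
    relLength M L = relLength M N + relLength (M ⊓ N) L := by
  have hLN : L ≤ N.comap LinearMap.id := h
  have hmk : ∀ x, (L.mapQ N .id hLN) (L.mkQ x) = N.mkQ x := fun x ↦ rfl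
  have hmap : ∀ y ∈ M.map L.mkQ, L.mapQ N .id hLN y ∈ M.map N.mkQ := by
    rintro _ ⟨x, hx, rfl⟩
    exact ⟨x, hx, rfl⟩
  have hsub : (M ⊓ N).map L.mkQ ≤ M.map L.mkQ := Submodule.map_mono inf_le_left
  rw [add_comm]
  refine Module.length_eq_add_of_exact (Submodule.inclusion hsub)
    ((L.mapQ N .id hLN).restrict hmap) (Submodule.inclusion_injective _) ?_ ?_
  · rintro ⟨_, x, hx, rfl⟩
    exact ⟨⟨_, x, hx, rfl⟩, rfl⟩
  · rintro ⟨_, x, hx, rfl⟩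
    constructor
    · intro h0
      have h0' : N.mkQ x = 0 := congrArg Subtype.val h0
      have hxN : x ∈ N := by simpa using h0'
      exact ⟨⟨_, x, ⟨hx, hxN⟩, rfl⟩, rfl⟩
    · rintro ⟨⟨_, y, hy, rfl⟩, hyx⟩
      have hyx' : L.mkQ y = L.mkQ x := congrArg Subtype.val hyx
      apply Subtype.ext
      change L.mapQ N .id hLN (L.mkQ x) = 0
      rw [← hyx', hmk]
      simpa using hy.2

theorem relLength_trans {L N M : Submodule K V} (h : L ≤ N) (h' : N ≤ M) :
    relLength M L = relLength M N + relLength N L := by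
  rw [relLength_eq_add M h, inf_eq_right.mpr h']

theorem relLength_inf_right (M N : Submodule K V) : relLength M (M ⊓ N) = relLength M N :=
  relLength_congr_right (by simp)

theorem relLength_inf_eq_sup (M N : Submodule K V) :
    relLength M (M ⊓ N) = relLength (M ⊔ N) N := by
  rw [relLength_sup_of_le le_rfl, relLength_inf_right]

/-- The identity behind the Frölicher-type equality for double complexes: the left-hand side is
the dimension of Bott–Chern plus Aeppli cohomology. -/
theorem relLength_bottChern_add_aeppli {k₁ k₂ i₁ i₂ kD iD : Submodule K V}
    (h₁ : i₁ ≤ k₁) (h₂ : i₂ ≤ k₂) (hi : iD ≤ i₁ ⊓ i₂) (hk : k₁ ⊔ k₂ ≤ kD) :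
    relLength (k₁ ⊓ k₂) iD + relLength kD (i₁ ⊔ i₂) =
      relLength k₁ i₁ + relLength k₂ i₂ + relLength kD (k₁ ⊔ k₂) + relLength (i₁ ⊓ i₂) iD := by
  have bc : relLength (k₁ ⊓ k₂) iD = relLength (k₁ ⊓ k₂) (i₁ ⊓ k₂) +
      (relLength (i₁ ⊓ k₂) (i₁ ⊓ i₂) + relLength (i₁ ⊓ i₂) iD) := by
    rw [← relLength_trans hi (inf_le_inf_left _ h₂),
      ← relLength_trans (hi.trans (inf_le_inf_left _ h₂)) (inf_le_inf_right _ h₁)]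
  have ae : relLength kD (i₁ ⊔ i₂) = relLength kD (k₁ ⊔ k₂) +
      (relLength (k₁ ⊔ k₂) (i₁ ⊔ k₂) + relLength (i₁ ⊔ k₂) (i₁ ⊔ i₂)) := by
    rw [← relLength_trans (sup_le_sup_left h₂ _) (sup_le_sup_right h₁ _),
      ← relLength_trans (sup_le_sup h₁ h₂) hk]
  have e₁ : relLength k₁ i₁ = relLength (k₁ ⊔ k₂) (i₁ ⊔ k₂) +
      relLength (k₁ ⊓ k₂) (i₁ ⊓ k₂) := by
    have hm : k₁ ⊓ (i₁ ⊔ k₂) = (k₁ ⊓ k₂) ⊔ i₁ := by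
      rw [inf_comm, sup_inf_assoc_of_le _ h₁, inf_comm, sup_comm]
    have hs : k₁ ⊔ (i₁ ⊔ k₂) = k₁ ⊔ k₂ := by
      rw [← sup_assoc, sup_eq_left.mpr h₁]
    have hi' : (k₁ ⊓ k₂) ⊓ i₁ = i₁ ⊓ k₂ := by
      rw [inf_right_comm, inf_eq_right.mpr h₁]
    rw [relLength_eq_add k₁ (le_sup_left : i₁ ≤ i₁ ⊔ k₂), hm, ← relLength_inf_eq_sup, hi',
      ← hs, ← relLength_inf_eq_sup, relLength_inf_right]
  have e₂ : relLength k₂ i₂ = relLength (i₁ ⊔ k₂) (i₁ ⊔ i₂) +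
      relLength (i₁ ⊓ k₂) (i₁ ⊓ i₂) := by
    have hm : k₂ ⊓ (i₁ ⊔ i₂) = (i₁ ⊓ k₂) ⊔ i₂ := by
      rw [inf_comm, sup_comm, sup_inf_assoc_of_le _ h₂, sup_comm]
    have hs : k₂ ⊔ (i₁ ⊔ i₂) = i₁ ⊔ k₂ := by
      rw [sup_left_comm, sup_eq_left.mpr h₂]
    have hi' : (i₁ ⊓ k₂) ⊓ i₂ = i₁ ⊓ i₂ := by
      rw [inf_assoc, inf_eq_right.mpr h₂]
    rw [relLength_eq_add k₂ (le_sup_right : i₂ ≤ i₁ ⊔ i₂), hm, ← relLength_inf_eq_sup, hi',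
      ← hs, ← relLength_inf_eq_sup, relLength_inf_right]
  rw [bc, ae, e₁, e₂]
  ring

/-- If `M' / N' → M / N` is an isomorphism induced by inclusions of subspaces stable under an
idempotent, then so is its restriction to the image of the idempotent. -/
theorem relLength_inf_range_eq {M N M' N' : Submodule K V} (e : V →ₗ[K] V)
    (hid : ∀ x, e (e x) = e x) (hM' : ∀ x ∈ M', e x ∈ M') (hN : ∀ x ∈ N, e x ∈ N)
    (hN'N : N' ≤ N) (hle : M' ≤ M ⊔ N) (hge : M ≤ M' ⊔ N) (hM : ∀ x ∈ M, e x ∈ M)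
    (hinf : M' ⊓ N ≤ N') :
    relLength (M' ⊓ range e) N' = relLength (M ⊓ range e) N := by
  have key : ∀ {A C : Submodule K V}, A ≤ C ⊔ N → (∀ x ∈ C, e x ∈ C) →
      A ⊓ range e ≤ (C ⊓ range e) ⊔ N := by
    rintro A C hAC hC x ⟨hx, y, rfl⟩
    obtain ⟨c, hc, n, hn, hcn⟩ := Submodule.mem_sup.mp (hAC hx)
    rw [← hid, ← hcn, map_add]
    exact Submodule.add_mem_sup ⟨hC c hc, c, rfl⟩ (hN n hn)
  have h1 : relLength (M' ⊓ range e) N' = relLength (M' ⊓ range e) N := by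
    apply relLength_congr_right
    apply le_antisymm
    · exact inf_le_inf_left _ hN'N
    · exact fun x hx ↦ ⟨hx.1, hinf ⟨hx.1.1, hx.2⟩⟩
  rw [h1, ← relLength_sup_of_le (le_refl N), ← relLength_sup_of_le (M := M ⊓ _) (le_refl N)]
  congr 1
  exact le_antisymm (sup_le (key hle hM) le_sup_right) (sup_le (key hge hM') le_sup_right)

end RelLength

section Projections

variable {K V : Type*} [Field K] [AddCommGroup V] [Module K V]

/-- `e` is a family of pairwise orthogonal idempotents indexed by `ℤ`, supported on the finite
set `s` and with sum the identity. -/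
structure IsProjFamily (e : ℤ → V →ₗ[K] V) (s : Finset ℤ) : Prop where
  idem : ∀ n x, e n (e n x) = e n x
  orth : ∀ n m x, n ≠ m → e n (e m x) = 0
  sum_eq : ∀ x, ∑ n ∈ s, e n x = x

/-- `M` is a graded subspace with respect to the family of projections `e`. -/
def IsGradedSub (e : ℤ → V →ₗ[K] V) (M : Submodule K V) : Prop :=
  ∀ n, ∀ x ∈ M, e n x ∈ M

/-- `δ` is homogeneous of degree `c` with respect to the family of projections `e`. -/
def IsHomogOfDegree (e : ℤ → V →ₗ[K] V) (δ : V →ₗ[K] V) (c : ℤ) : Prop :=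
  ∀ n x, δ (e n x) = e (n + c) (δ x)

variable {e : ℤ → V →ₗ[K] V} {s : Finset ℤ}

theorem IsHomogOfDegree.ker {δ : V →ₗ[K] V} {c : ℤ} (h : IsHomogOfDegree e δ c) :
    IsGradedSub e (ker δ) := by
  intro n x hx
  rw [mem_ker] at hx ⊢
  rw [h, hx, map_zero]

theorem IsHomogOfDegree.range {δ : V →ₗ[K] V} {c : ℤ} (h : IsHomogOfDegree e δ c) :
    IsGradedSub e (range δ) := by
  rintro n _ ⟨x, rfl⟩
  exact ⟨e (n - c) x, by rw [h, sub_add_cancel]⟩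

theorem IsHomogOfDegree.comp {δ δ' : V →ₗ[K] V} {c c' : ℤ} (h : IsHomogOfDegree e δ c)
    (h' : IsHomogOfDegree e δ' c') : IsHomogOfDegree e (δ ∘ₗ δ') (c' + c) := by
  intro n x
  rw [comp_apply, h', h, comp_apply, add_assoc]

theorem IsHomogOfDegree.add {δ δ' : V →ₗ[K] V} {c : ℤ} (h : IsHomogOfDegree e δ c)
    (h' : IsHomogOfDegree e δ' c) : IsHomogOfDegree e (δ + δ') c := by
  intro n x
  rw [LinearMap.add_apply, h', h, LinearMap.add_apply, map_add]

theorem IsGradedSub.inf {M N : Submodule K V} (hM : IsGradedSub e M) (hN : IsGradedSub e N) :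
    IsGradedSub e (M ⊓ N) :=
  fun n x hx ↦ ⟨hM n x hx.1, hN n x hx.2⟩

theorem IsGradedSub.sup {M N : Submodule K V} (hM : IsGradedSub e M) (hN : IsGradedSub e N) :
    IsGradedSub e (M ⊔ N) := by
  intro n x hx
  obtain ⟨a, ha, b, hb, rfl⟩ := Submodule.mem_sup.mp hx
  rw [map_add]
  exact Submodule.add_mem_sup (hM n a ha) (hN n b hb)

theorem IsProjFamily.range_eq_bot (he : IsProjFamily e s) {n : ℤ} (hn : n ∉ s) :
    LinearMap.range (e n) = ⊥ := by
  rw [LinearMap.range_eq_bot]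
  ext x
  rw [← he.sum_eq (e n x), LinearMap.zero_apply]
  exact Finset.sum_eq_zero fun m hm ↦ he.orth m n x (by rintro rfl; exact hn hm)

theorem relLength_eq_range_add_ker {M N : Submodule K V} (f : V →ₗ[K] V)
    (hid : ∀ x, f (f x) = f x) (hM : ∀ x ∈ M, f x ∈ M) (hN : ∀ x ∈ N, f x ∈ N) :
    relLength M N = relLength (M ⊓ range f) N + relLength (M ⊓ LinearMap.ker f) N := by
  have hsplit : M = (M ⊓ LinearMap.range f) ⊔ (M ⊓ LinearMap.ker f) := by
    apply le_antisymm
    · intro x hx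
      rw [← add_sub_cancel (f x) x]
      refine Submodule.add_mem_sup ⟨hM x hx, x, rfl⟩ ⟨sub_mem hx (hM x hx), ?_⟩
      rw [SetLike.mem_coe, mem_ker, map_sub, hid, sub_self]
    · exact sup_le inf_le_left inf_le_left
  rw [relLength_eq_add M (le_sup_right : N ≤ (M ⊓ LinearMap.ker f) ⊔ N)]
  congr 1
  · conv_lhs => rw [hsplit]
    rw [relLength_sup_of_le]
    swap
    · exact hsplit ▸ le_sup_left
    apply relLength_congr_right
    apply le_antisymm
    · rintro x ⟨⟨hx, y, rfl⟩, hx'⟩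
      rw [← hsplit] at hx'
      refine ⟨⟨hx, y, rfl⟩, ?_⟩
      obtain ⟨c, hc, n, hn, hcn⟩ := Submodule.mem_sup.mp hx'
      rw [← hid, ← hcn, map_add, mem_ker.mp hc.2, zero_add]
      exact hN n hn
    · exact inf_le_inf_left _ le_sup_right
  · rw [inf_comm, sup_inf_assoc_of_le _ inf_le_left, sup_comm, inf_comm]
    rw [← relLength_sup_of_le (M := M ⊓ LinearMap.ker f) (inf_le_right : M ⊓ N ≤ N), sup_comm]

theorem IsProjFamily.relLength_eq_sum (he : IsProjFamily e s) {M N : Submodule K V}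
    (hM : IsGradedSub e M) (hN : IsGradedSub e N) :
    relLength M N = ∑ n ∈ s, relLength (M ⊓ LinearMap.range (e n)) N := by
  have key : ∀ t : Finset ℤ, relLength M N =
      ∑ n ∈ t, relLength (M ⊓ LinearMap.range (e n)) N +
        relLength (M ⊓ ⨅ n ∈ t, LinearMap.ker (e n)) N := by
    intro t
    induction t using Finset.induction_on with
    | empty => simp
    | insert a t ha ih =>
      rw [ih, Finset.sum_insert ha, add_comm (relLength _ _), add_assoc]
      congr 1
      have hinv : ∀ x ∈ M ⊓ ⨅ n ∈ t, LinearMap.ker (e n),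
          e a x ∈ M ⊓ ⨅ n ∈ t, LinearMap.ker (e n) := by
        intro x hx
        refine ⟨hM a x hx.1, ?_⟩
        simp only [SetLike.mem_coe, Submodule.mem_iInf, mem_ker]
        exact fun n hn ↦ he.orth n a x (by rintro rfl; exact ha hn)
      rw [relLength_eq_range_add_ker (e a) (he.idem a) hinv (hN a)]
      congr 2
      · apply le_antisymm
        · exact inf_le_inf_right _ inf_le_left
        · rintro _ ⟨hx, y, rfl⟩
          refine ⟨⟨hx, ?_⟩, y, rfl⟩
          simp only [SetLike.mem_coe, Submodule.mem_iInf, mem_ker]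
          exact fun n hn ↦ he.orth n a y (by rintro rfl; exact ha hn)
      · rw [Finset.iInf_insert, inf_assoc, inf_comm (⨅ n ∈ t, _)]
  have hbot : M ⊓ ⨅ n ∈ s, LinearMap.ker (e n) = ⊥ := by
    rw [eq_bot_iff]
    rintro x ⟨-, hx⟩
    simp only [SetLike.mem_coe, Submodule.mem_iInf, mem_ker] at hx
    rw [Submodule.mem_bot, ← he.sum_eq x]
    exact Finset.sum_eq_zero hx
  rw [key s, hbot, relLength_bot_left, add_zero]

/-- The spectral-sequence inequality: if `d = δ + ε` where `δ` preserves the grading and `ε`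
raises it by one, then the cohomology of `d` is at most as large as the cohomology of `δ`. -/
theorem IsProjFamily.relLength_add_le (he : IsProjFamily e s) {δ ε : V →ₗ[K] V}
    (hδ : IsHomogOfDegree e δ 0) (hε : IsHomogOfDegree e ε 1)
    (hd : ∀ x, (δ + ε) ((δ + ε) x) = 0) :
    relLength (LinearMap.ker (δ + ε)) (LinearMap.range (δ + ε)) ≤
      relLength (LinearMap.ker δ) (LinearMap.range δ) := by
  obtain ⟨a, b, hab⟩ : ∃ a b : ℤ, s ⊆ Finset.Ico a b := by
    obtain ⟨a, ha⟩ := s.bddBelow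
    obtain ⟨b, hb⟩ := s.bddAbove
    exact ⟨a, b + 1, fun n hn ↦ Finset.mem_Ico.mpr
      ⟨ha hn, Int.lt_add_one_of_le (hb hn)⟩⟩
  have he' : IsProjFamily e (Finset.Ico a b) := by
    refine ⟨he.idem, he.orth, fun x ↦ ?_⟩
    rw [← Finset.sum_subset hab, he.sum_eq]
    intro n _ hn
    have := he.range_eq_bot hn
    rw [LinearMap.range_eq_bot] at this
    rw [this, LinearMap.zero_apply]
  set d := δ + ε with hdef
  let F : ℤ → Submodule K V := fun n ↦ ⨅ m, ⨅ (_ : m < n), LinearMap.ker (e m)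
  have hF : ∀ n x, x ∈ F n ↔ ∀ m < n, e m x = 0 := by
    intro n x
    simp [F, Submodule.mem_iInf]
  have hFsucc : ∀ n x, x ∈ F n → e n x = 0 → x ∈ F (n + 1) := by
    intro n x hx hnx
    rw [hF] at hx ⊢
    intro m hm
    rcases (Int.lt_add_one_iff.mp hm).lt_or_eq with h | rfl
    · exact hx m h
    · exact hnx
  have hδ' : ∀ n x, e n (δ x) = δ (e n x) := fun n x ↦ by rw [hδ, add_zero]
  have hε' : ∀ n x, e n (ε x) = ε (e (n - 1) x) := fun n x ↦ by rw [hε, sub_add_cancel]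
  have hlead : ∀ n x, x ∈ F n → e n (d x) = δ (e n x) := by
    intro n x hx
    rw [hdef, LinearMap.add_apply, map_add, hδ', hε', (hF n x).mp hx (n - 1) (by lia), map_zero, add_zero]
  have hFe : ∀ n x, e n x ∈ F n := fun n x ↦
    (hF _ _).mpr fun m hm ↦ he.orth m n x hm.ne
  have hFd : ∀ n x, x ∈ F n → d x ∈ F n := by
    intro n x hx
    rw [hF] at hx ⊢
    intro m hm
    rw [hdef, LinearMap.add_apply, map_add, hδ', hε', hx _ hm, hx _ (by lia), map_zero, map_zero,
      add_zero]
  have step : ∀ n, relLength (LinearMap.ker d ⊓ F n) (LinearMap.range d) ≤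
      relLength (LinearMap.ker δ ⊓ LinearMap.range (e n)) (LinearMap.range δ) +
        relLength (LinearMap.ker d ⊓ F (n + 1)) (LinearMap.range d) := by
    intro n
    have hle : LinearMap.range d ≤ (LinearMap.ker d ⊓ F (n + 1)) ⊔ LinearMap.range d :=
      le_sup_right
    rw [relLength_eq_add _ hle]
    apply add_le_add
    · refine relLength_le_of_map (e n) ?_ ?_
      · rintro x ⟨hx, hxF⟩
        refine ⟨?_, x, rfl⟩
        rw [SetLike.mem_coe, mem_ker, ← hlead n x hxF, mem_ker.mp hx, map_zero]
      · rintro x ⟨hx, hxF⟩ ⟨y, hy⟩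
        rw [← sub_add_cancel x (d (e n y))]
        refine Submodule.add_mem_sup ⟨?_, ?_⟩ ⟨_, rfl⟩
        · rw [SetLike.mem_coe, mem_ker, map_sub, mem_ker.mp hx, hd, sub_zero]
        · apply hFsucc
          · exact sub_mem hxF (hFd n _ (hFe n y))
          · rw [map_sub, hlead n _ (hFe n y), he.idem, ← hδ', hy, he.idem, sub_self]
    · rw [← relLength_sup_of_le (le_refl _),
        ← relLength_sup_of_le (M := _ ⊓ F (n + 1)) (le_refl _)]
      have hle' : LinearMap.ker d ⊓ F n ⊓ (LinearMap.ker d ⊓ F (n + 1) ⊔ LinearMap.range d) ⊔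
          LinearMap.range d ≤ LinearMap.ker d ⊓ F (n + 1) ⊔ LinearMap.range d :=
        sup_le inf_le_right le_sup_right
      exact relLength_le_of_map .id (fun x hx ↦ hle' hx) fun x _ hx ↦ hx
  have hind : ∀ j : ℕ, relLength (LinearMap.ker d ⊓ F (b - j)) (LinearMap.range d) ≤
      ∑ n ∈ Finset.Ico (b - j) b,
        relLength (LinearMap.ker δ ⊓ LinearMap.range (e n)) (LinearMap.range δ) := by
    intro j
    induction j with
    | zero =>
      have : F b = ⊥ := by
        rw [eq_bot_iff]
        intro x hx
        rw [Submodule.mem_bot, ← he'.sum_eq x]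
        exact Finset.sum_eq_zero fun m hm ↦ (hF b x).mp hx m (Finset.mem_Ico.mp hm).2
      simp [this, relLength_bot_left]
    | succ j ih =>
      have hb : b - ((j + 1 : ℕ) : ℤ) + 1 = b - j := by push_cast; ring
      have hs := step (b - ((j + 1 : ℕ) : ℤ))
      rw [hb] at hs
      refine hs.trans ?_
      have hI : Finset.Ico (b - ((j + 1 : ℕ) : ℤ)) b =
          insert (b - ((j + 1 : ℕ) : ℤ)) (Finset.Ico (b - j) b) := by
        ext m
        simp only [Finset.mem_Ico, Finset.mem_insert]
        lia
      rw [hI, Finset.sum_insert (by simp only [Finset.mem_Ico]; lia)]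
      gcongr
  rw [he'.relLength_eq_sum hδ.ker hδ.range]
  by_cases hab' : a ≤ b
  · have htop : F a = ⊤ := by
      rw [eq_top_iff]
      intro x _
      rw [hF]
      intro m hm
      have := he'.range_eq_bot (n := m) (by simp only [Finset.mem_Ico]; lia)
      rw [LinearMap.range_eq_bot] at this
      rw [this, LinearMap.zero_apply]
    have := hind (b - a).toNat
    rwa [Int.toNat_of_nonneg (by lia), sub_sub_cancel, htop, inf_top_eq] at this
  · have hbot : LinearMap.ker d = ⊥ := by
      rw [eq_bot_iff]
      intro x _
      rw [Submodule.mem_bot, ← he'.sum_eq x, Finset.Ico_eq_empty (by lia), Finset.sum_empty]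
    rw [hbot, relLength_bot_left]
    exact zero_le

end Projections

section Grading

variable {K V : Type*} [Field K] [AddCommGroup V] [Module K V]
variable {B : ℤ × ℤ → Submodule K V}

/-- The operator acting on the piece `B i` of an internal direct sum as the scalar `φ i`. -/
noncomputable def diagOp (hB : DirectSum.IsInternal B) (φ : ℤ × ℤ → K) : V →ₗ[K] V :=
  DirectSum.toModule K (ℤ × ℤ) V (fun i ↦ φ i • (B i).subtype) ∘ₗ
    (LinearEquiv.ofBijective (DirectSum.coeLinearMap B) hB).symm.toLinearMap

theorem diagOp_apply_of_mem (hB : DirectSum.IsInternal B) (φ : ℤ × ℤ → K) {i : ℤ × ℤ} {x : V}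
    (hx : x ∈ B i) : diagOp hB φ x = φ i • x := by
  have h : (LinearEquiv.ofBijective (DirectSum.coeLinearMap B) hB).symm x =
      DirectSum.lof K (ℤ × ℤ) (fun i ↦ B i) i ⟨x, hx⟩ :=
    (LinearEquiv.symm_apply_eq _).mpr (DirectSum.coeLinearMap_lof B i ⟨x, hx⟩).symm
  rw [diagOp, comp_apply, LinearEquiv.coe_coe, h, DirectSum.toModule_lof]
  rfl

theorem linearMap_ext_of_isInternal (hB : DirectSum.IsInternal B) {f g : V →ₗ[K] V}
    (h : ∀ i, ∀ x ∈ B i, f x = g x) : f = g := by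
  ext x
  have hx : x ∈ iSup B := by rw [hB.submodule_iSup_eq_top]; trivial
  induction hx using Submodule.iSup_induction' with
  | mem i x hx => exact h i x hx
  | zero => simp
  | add x y _ _ hx hy => rw [map_add, map_add, hx, hy]

theorem diagOp_diagOp (hB : DirectSum.IsInternal B) (φ ψ : ℤ × ℤ → K) (x : V) :
    diagOp hB φ (diagOp hB ψ x) = diagOp hB (φ * ψ) x := by
  rw [← comp_apply]
  congr 1
  refine linearMap_ext_of_isInternal hB fun i x hx ↦ ?_
  rw [comp_apply, diagOp_apply_of_mem hB ψ hx, map_smul, diagOp_apply_of_mem hB φ hx,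
    diagOp_apply_of_mem hB _ hx, smul_smul, Pi.mul_apply, mul_comm]

theorem range_diagOp_le (hB : DirectSum.IsInternal B) (φ : ℤ × ℤ → K) {M : Submodule K V}
    (h : ∀ i, φ i ≠ 0 → B i ≤ M) : LinearMap.range (diagOp hB φ) ≤ M := by
  rw [LinearMap.range_eq_map, ← hB.submodule_iSup_eq_top, Submodule.map_iSup, iSup_le_iff]
  rintro i _ ⟨x, hx, rfl⟩
  rw [diagOp_apply_of_mem hB φ hx]
  by_cases hi : φ i = 0
  · rw [hi, zero_smul]
    exact zero_mem M
  · exact M.smul_mem _ (h i hi hx)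

/-- The projection onto the sum of the pieces `B i` with `g i = n`. -/
noncomputable def gradProj (hB : DirectSum.IsInternal B) (g : ℤ × ℤ → ℤ) (n : ℤ) : V →ₗ[K] V :=
  diagOp hB fun i ↦ if g i = n then 1 else 0

theorem gradProj_apply_of_mem (hB : DirectSum.IsInternal B) (g : ℤ × ℤ → ℤ) (n : ℤ)
    {i : ℤ × ℤ} {x : V} (hx : x ∈ B i) :
    gradProj hB g n x = if g i = n then x else 0 := by
  rw [gradProj, diagOp_apply_of_mem hB _ hx]
  split_ifs <;> simp

theorem isProjFamily_gradProj (hB : DirectSum.IsInternal B)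
    (hbounded : {pq : ℤ × ℤ | B pq ≠ ⊥}.Finite) (g : ℤ × ℤ → ℤ) :
    IsProjFamily (gradProj hB g) (hbounded.toFinset.image g) where
  idem n x := by
    rw [gradProj, diagOp_diagOp]
    congr 2
    ext i
    simp
  orth n m x hnm := by
    have : gradProj hB g n ∘ₗ gradProj hB g m = 0 := by
      refine linearMap_ext_of_isInternal hB fun i x hx ↦ ?_
      rw [comp_apply, gradProj_apply_of_mem hB g m hx]
      split_ifs with h
      · rw [gradProj_apply_of_mem hB g n hx, if_neg (by rintro rfl; exact hnm h)]
        simp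
      · simp
    exact LinearMap.congr_fun this x
  sum_eq x := by
    have : ∑ n ∈ hbounded.toFinset.image g, gradProj hB g n = LinearMap.id := by
      refine linearMap_ext_of_isInternal hB fun i x hx ↦ ?_
      rw [LinearMap.sum_apply, id_apply]
      simp_rw [gradProj_apply_of_mem hB g _ hx]
      rw [Finset.sum_ite_eq]
      split_ifs with h
      · rfl
      · by_contra hne
        refine h (Finset.mem_image_of_mem g ?_)
        rw [Set.Finite.mem_toFinset, Set.mem_ofPred_eq]
        intro hbot
        rw [hbot, Submodule.mem_bot] at hx
        exact hne hx.symm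
    simpa using LinearMap.congr_fun this x

theorem isHomogOfDegree_gradProj (hB : DirectSum.IsInternal B) (g : ℤ × ℤ → ℤ)
    {δ : V →ₗ[K] V} {c : ℤ} (σ : ℤ × ℤ → ℤ × ℤ) (hσ : ∀ i, g (σ i) = g i + c)
    (hδ : ∀ i, (B i).map δ ≤ B (σ i)) : IsHomogOfDegree (gradProj hB g) δ c := by
  intro n x
  rw [← comp_apply, ← comp_apply]
  congr 1
  refine linearMap_ext_of_isInternal hB fun i x hx ↦ ?_
  rw [comp_apply, comp_apply, gradProj_apply_of_mem hB g n hx,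
    gradProj_apply_of_mem hB g _ (hδ i (Submodule.mem_map_of_mem hx)), hσ]
  simp only [add_left_inj]
  split_ifs <;> simp

theorem le_range_gradProj (hB : DirectSum.IsInternal B) (g : ℤ × ℤ → ℤ) (i : ℤ × ℤ) :
    B i ≤ LinearMap.range (gradProj hB g (g i)) :=
  fun x hx ↦ ⟨x, by rw [gradProj_apply_of_mem hB g _ hx, if_pos rfl]⟩

theorem range_gradProj_total (hB : DirectSum.IsInternal B) (k : ℤ) :
    LinearMap.range (gradProj hB (fun i ↦ i.1 + i.2) k) = TotalPiece B k := by
  apply le_antisymm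
  · refine range_diagOp_le hB _ fun i hi ↦ ?_
    have hi' : i.1 + i.2 = k := by
      by_contra h
      exact hi (if_neg h)
    have : i = (i.1, k - i.1) := by ext <;> simp [← hi']
    rw [this]
    exact le_iSup (fun p ↦ B (p, k - p)) i.1
  · refine iSup_le fun p ↦ ?_
    have := le_range_gradProj hB (fun i ↦ i.1 + i.2) (p, k - p)
    rwa [add_sub_cancel] at this

theorem range_gradProj_inf_range_gradProj (hB : DirectSum.IsInternal B) (k p : ℤ) :
    LinearMap.range (gradProj hB (fun i ↦ i.1 + i.2) k) ⊓
      LinearMap.range (gradProj hB Prod.fst p) = B (p, k - p) := by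
  apply le_antisymm
  · rintro _ ⟨⟨x, rfl⟩, ⟨y, hy⟩⟩
    have h : gradProj hB Prod.fst p (gradProj hB (fun i ↦ i.1 + i.2) k x) =
        gradProj hB (fun i ↦ i.1 + i.2) k x := by
      rw [← hy, gradProj, diagOp_diagOp]
      congr 2
      ext i
      simp
    rw [← h, gradProj, gradProj, diagOp_diagOp]
    refine range_diagOp_le hB _ (fun i hi ↦ ?_) ⟨x, rfl⟩
    have hi1 : i.1 = p := by
      by_contra h
      exact hi (by simp [h])
    have hi2 : i.1 + i.2 = k := by
      by_contra h
      exact hi (by simp [h])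
    have : i = (p, k - p) := by ext <;> simp [← hi2, hi1]
    rw [this]
  · refine le_inf ?_ (le_range_gradProj hB Prod.fst (p, k - p))
    have := le_range_gradProj hB (fun i ↦ i.1 + i.2) (p, k - p)
    rwa [add_sub_cancel] at this

/-- The length of a graded subquotient in total degree `k` is the sum of the lengths of its
homogeneous pieces. -/
theorem relLength_inf_totalPiece (hB : DirectSum.IsInternal B)
    (hbounded : {pq : ℤ × ℤ | B pq ≠ ⊥}.Finite) {M N : Submodule K V}
    (hM : IsGradedSub (gradProj hB Prod.fst) M) (hN : IsGradedSub (gradProj hB Prod.fst) N)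
    (k : ℤ) :
    relLength (M ⊓ TotalPiece B k) N =
      ∑ p ∈ hbounded.toFinset.image Prod.fst, relLength (M ⊓ B (p, k - p)) N := by
  have hT : IsGradedSub (gradProj hB Prod.fst) (TotalPiece B k) := by
    rw [← range_gradProj_total hB]
    rintro p _ ⟨x, rfl⟩
    refine ⟨gradProj hB Prod.fst p x, ?_⟩
    rw [gradProj, gradProj, diagOp_diagOp, diagOp_diagOp, mul_comm]
  rw [(isProjFamily_gradProj hB hbounded Prod.fst).relLength_eq_sum (hM.inf hT) hN]
  refine Finset.sum_congr rfl fun p _ ↦ ?_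
  rw [inf_assoc, ← range_gradProj_total hB, range_gradProj_inf_range_gradProj]

theorem relLength_eq_sum_totalPiece (hB : DirectSum.IsInternal B)
    (hbounded : {pq : ℤ × ℤ | B pq ≠ ⊥}.Finite) {M N : Submodule K V}
    (hM : IsGradedSub (gradProj hB fun i ↦ i.1 + i.2) M)
    (hN : IsGradedSub (gradProj hB fun i ↦ i.1 + i.2) N) :
    relLength M N = ∑ k ∈ hbounded.toFinset.image (fun i ↦ i.1 + i.2),
      relLength (M ⊓ TotalPiece B k) N := by
  rw [(isProjFamily_gradProj hB hbounded _).relLength_eq_sum hM hN]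
  simp_rw [range_gradProj_total]

theorem eq_bot_of_notMem_image_fst (hbounded : {pq : ℤ × ℤ | B pq ≠ ⊥}.Finite) {p : ℤ}
    (hp : p ∉ hbounded.toFinset.image Prod.fst) (q : ℤ) : B (p, q) = ⊥ := by
  by_contra h
  exact hp (Finset.mem_image.mpr ⟨(p, q), by simpa using h, rfl⟩)

end Grading

section DoubleComplex

variable {K V : Type*} [Field K] [AddCommGroup V] [Module K V]

theorem relLength_ne_top_of_pieces {B : ℤ × ℤ → Submodule K V} (hB : DirectSum.IsInternal B)
    (hbounded : {pq : ℤ × ℤ | B pq ≠ ⊥}.Finite) {M N : Submodule K V}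
    (hMt : IsGradedSub (gradProj hB fun i ↦ i.1 + i.2) M)
    (hNt : IsGradedSub (gradProj hB fun i ↦ i.1 + i.2) N)
    (hMp : IsGradedSub (gradProj hB Prod.fst) M) (hNp : IsGradedSub (gradProj hB Prod.fst) N)
    (h : ∀ p q, FiniteDimensional K (SubQuot (M ⊓ B (p, q)) N)) : relLength M N ≠ ⊤ := by
  rw [relLength_eq_sum_totalPiece hB hbounded hMt hNt]
  simp_rw [relLength_inf_totalPiece hB hbounded hMp hNp]
  simp only [ne_eq, ENat.sum_eq_top, not_exists, not_and]
  exact fun k _ p _ ↦ (relLength_ne_top_iff _ _).mpr (h p (k - p))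

theorem cast_finsum_finrank_eq {B : ℤ × ℤ → Submodule K V} (hB : DirectSum.IsInternal B)
    (hbounded : {pq : ℤ × ℤ | B pq ≠ ⊥}.Finite) {M N M' N' : Submodule K V}
    (hM : IsGradedSub (gradProj hB Prod.fst) M) (hN : IsGradedSub (gradProj hB Prod.fst) N)
    (hM' : IsGradedSub (gradProj hB Prod.fst) M') (hN' : IsGradedSub (gradProj hB Prod.fst) N')
    (h : ∀ p q, FiniteDimensional K (SubQuot (M ⊓ B (p, q)) N) ∧
      FiniteDimensional K (SubQuot (M' ⊓ B (p, q)) N')) (k : ℤ) :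
    ((∑ᶠ p : ℤ, (finrank K (SubQuot (M ⊓ B (p, k - p)) N) +
      finrank K (SubQuot (M' ⊓ B (p, k - p)) N')) : ℕ) : ℕ∞) =
      relLength (M ⊓ TotalPiece B k) N + relLength (M' ⊓ TotalPiece B k) N' := by
  have hr : ∀ p, ((finrank K (SubQuot (M ⊓ B (p, k - p)) N) +
      finrank K (SubQuot (M' ⊓ B (p, k - p)) N') : ℕ) : ℕ∞) =
      relLength (M ⊓ B (p, k - p)) N + relLength (M' ⊓ B (p, k - p)) N' := by
    intro p
    have := (h p (k - p)).1
    have := (h p (k - p)).2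
    rw [relLength_eq_finrank, relLength_eq_finrank, Nat.cast_add]
  rw [finsum_eq_sum_of_support_subset (s := hbounded.toFinset.image Prod.fst),
    relLength_inf_totalPiece hB hbounded hM hN, relLength_inf_totalPiece hB hbounded hM' hN',
    Nat.cast_sum, ← Finset.sum_add_distrib]
  · exact Finset.sum_congr rfl fun p _ ↦ hr p
  · intro p hp
    by_contra hps
    apply hp
    have hb : B (p, k - p) = ⊥ := eq_bot_of_notMem_image_fst hbounded (by simpa using hps) _
    have h0 : relLength (M ⊓ B (p, k - p)) N + relLength (M' ⊓ B (p, k - p)) N' = 0 := by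
      rw [hb, inf_bot_eq, inf_bot_eq, relLength_bot_left, relLength_bot_left, add_zero]
    rw [← hr p] at h0
    exact_mod_cast h0

variable {δ₁ δ₂ : V →ₗ[K] V}

theorem ker_inf_ker_add : ker δ₁ ⊓ ker (δ₁ + δ₂) = ker δ₁ ⊓ ker δ₂ := by
  ext x
  simp only [Submodule.mem_inf, mem_ker, LinearMap.add_apply]
  constructor <;> rintro ⟨h, h'⟩ <;> exact ⟨h, by simpa [h] using h'⟩

theorem range_sup_range_add : range δ₁ ⊔ range (δ₁ + δ₂) = range δ₁ ⊔ range δ₂ := by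
  apply le_antisymm
  · refine sup_le le_sup_left ?_
    rintro _ ⟨x, rfl⟩
    exact Submodule.add_mem_sup ⟨x, rfl⟩ ⟨x, rfl⟩
  · refine sup_le le_sup_left ?_
    rintro _ ⟨x, rfl⟩
    have : δ₂ x = δ₁ (-x) + (δ₁ + δ₂) x := by simp
    rw [this]
    exact Submodule.add_mem_sup ⟨_, rfl⟩ ⟨x, rfl⟩

theorem total_apply_total_apply (h1 : ∀ x, δ₁ (δ₁ x) = 0) (h2 : ∀ x, δ₂ (δ₂ x) = 0)
    (h12 : ∀ x, δ₁ (δ₂ x) = -δ₂ (δ₁ x)) (x : V) : (δ₁ + δ₂) ((δ₁ + δ₂) x) = 0 := by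
  simp [h1, h2, h12]

/-- `dim H_BC + dim H_A` in terms of the cohomologies of an anticommuting pair. -/
theorem relLength_bottChern_add_aeppli_of_anticomm (h1 : ∀ x, δ₁ (δ₁ x) = 0)
    (h2 : ∀ x, δ₂ (δ₂ x) = 0) (h12 : ∀ x, δ₁ (δ₂ x) = -δ₂ (δ₁ x)) :
    relLength (ker δ₁ ⊓ ker δ₂) (range (δ₁ ∘ₗ δ₂)) +
        relLength (ker (δ₁ ∘ₗ δ₂)) (range δ₁ ⊔ range δ₂) =
      relLength (ker δ₁) (range δ₁) + relLength (ker δ₂) (range δ₂) +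
        relLength (ker (δ₁ ∘ₗ δ₂)) (ker δ₁ ⊔ ker δ₂) +
        relLength (range δ₁ ⊓ range δ₂) (range (δ₁ ∘ₗ δ₂)) := by
  apply relLength_bottChern_add_aeppli
  · rintro _ ⟨x, rfl⟩
    exact h1 x
  · rintro _ ⟨x, rfl⟩
    exact h2 x
  · rintro _ ⟨x, rfl⟩
    exact ⟨⟨δ₂ x, rfl⟩, ⟨-δ₁ x, by simp [h12]⟩⟩
  · refine sup_le (fun x hx ↦ ?_) (fun x hx ↦ ?_)
    · rw [mem_ker, comp_apply, h12, mem_ker.mp hx, map_zero, neg_zero]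
    · rw [mem_ker, comp_apply, mem_ker.mp hx, map_zero]

/-- The variant of `relLength_bottChern_add_aeppli_of_anticomm` for the pair `δ₁`, `δ₁ + δ₂`. -/
theorem relLength_bottChern_add_aeppli_total (h1 : ∀ x, δ₁ (δ₁ x) = 0)
    (h2 : ∀ x, δ₂ (δ₂ x) = 0) (h12 : ∀ x, δ₁ (δ₂ x) = -δ₂ (δ₁ x)) :
    relLength (ker δ₁ ⊓ ker δ₂) (range (δ₁ ∘ₗ δ₂)) +
        relLength (ker (δ₁ ∘ₗ δ₂)) (range δ₁ ⊔ range δ₂) =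
      relLength (ker δ₁) (range δ₁) + relLength (ker (δ₁ + δ₂)) (range (δ₁ + δ₂)) +
        relLength (ker (δ₁ ∘ₗ δ₂)) (ker δ₁ ⊔ ker (δ₁ + δ₂)) +
        relLength (range δ₁ ⊓ range (δ₁ + δ₂)) (range (δ₁ ∘ₗ δ₂)) := by
  have hD : δ₁ ∘ₗ (δ₁ + δ₂) = δ₁ ∘ₗ δ₂ := by
    ext x
    simp [h1]
  have := relLength_bottChern_add_aeppli_of_anticomm (δ₂ := δ₁ + δ₂) h1
    (total_apply_total_apply h1 h2 h12) (fun x ↦ by simp [h1, h12])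
  rwa [hD, ker_inf_ker_add, range_sup_range_add] at this

/-- If `dim H_BC + dim H_A` equals twice the dimension of the total cohomology, which is finite
and bounded by the cohomologies of `δ₁` and of `δ₂`, then the `δ₁δ₂`-lemma holds. -/
theorem deldelbar_lemma_of_relLength_eq (h1 : ∀ x, δ₁ (δ₁ x) = 0)
    (h2 : ∀ x, δ₂ (δ₂ x) = 0) (h12 : ∀ x, δ₁ (δ₂ x) = -δ₂ (δ₁ x))
    (hfin : relLength (ker (δ₁ + δ₂)) (range (δ₁ + δ₂)) ≠ ⊤)
    (hle₁ : relLength (ker (δ₁ + δ₂)) (range (δ₁ + δ₂)) ≤ relLength (ker δ₁) (range δ₁))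
    (hle₂ : relLength (ker (δ₁ + δ₂)) (range (δ₁ + δ₂)) ≤ relLength (ker δ₂) (range δ₂))
    (heq : relLength (ker δ₁ ⊓ ker δ₂) (range (δ₁ ∘ₗ δ₂)) +
        relLength (ker (δ₁ ∘ₗ δ₂)) (range δ₁ ⊔ range δ₂) =
      2 * relLength (ker (δ₁ + δ₂)) (range (δ₁ + δ₂))) :
    ker δ₁ ⊓ ker δ₂ ⊓ (range δ₁ ⊔ range δ₂) = range (δ₁ ∘ₗ δ₂) := by
  have h21 : ∀ x, δ₂ (δ₁ x) = -δ₁ (δ₂ x) := fun x ↦ by rw [h12, neg_neg]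
  have hneg : δ₂ ∘ₗ δ₁ = -(δ₁ ∘ₗ δ₂) := by
    ext x
    exact h21 x
  have aux : ∀ {h a b f g : ℕ∞}, h ≠ ⊤ → h ≤ a → h ≤ b → a + b + f + g = 2 * h →
      f = 0 ∧ g = 0 := by
    intro h a b f g hh ha hb hs
    have h2h : (2 : ℕ∞) * h ≠ ⊤ := by
      rw [two_mul]
      exact WithTop.add_ne_top.mpr ⟨hh, hh⟩
    rw [← hs] at h2h
    have hg := (WithTop.add_ne_top.mp h2h).2
    have h2h' := (WithTop.add_ne_top.mp h2h).1
    have hf := (WithTop.add_ne_top.mp h2h').2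
    have hab := WithTop.add_ne_top.mp (WithTop.add_ne_top.mp h2h').1
    lift h to ℕ using hh
    lift a to ℕ using hab.1
    lift b to ℕ using hab.2
    lift f to ℕ using hf
    lift g to ℕ using hg
    norm_cast at *
    lia
  have e₀ := relLength_bottChern_add_aeppli_of_anticomm h1 h2 h12
  have e₁ := relLength_bottChern_add_aeppli_total h1 h2 h12
  have e₂ := relLength_bottChern_add_aeppli_total h2 h1 h21
  rw [hneg, range_neg, inf_comm, sup_comm (range δ₂), add_comm δ₂, ker_neg] at e₂
  rw [heq] at e₀ e₁ e₂
  have hI := le_of_relLength_eq_zero (aux hfin hle₁ hle₂ e₀.symm).2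
  have hk₁ := le_of_relLength_eq_zero (aux hfin hle₁ le_rfl e₁.symm).1
  have hk₂ := le_of_relLength_eq_zero (aux hfin hle₂ le_rfl e₂.symm).1
  apply le_antisymm
  · rintro x ⟨⟨hx₁, hx₂⟩, hx⟩
    obtain ⟨_, ⟨a, rfl⟩, _, ⟨b, rfl⟩, rfl⟩ := Submodule.mem_sup.mp hx
    rw [SetLike.mem_coe, mem_ker, map_add] at hx₁ hx₂
    have hb : δ₁ (δ₂ b) = 0 := by simpa [h1] using hx₁
    have ha : δ₁ (δ₂ a) = 0 := by rw [h12, neg_eq_zero]; simpa [h2] using hx₂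
    obtain ⟨a₁, ha₁, a', ha', rfl⟩ := Submodule.mem_sup.mp (hk₁ (mem_ker.mpr ha))
    obtain ⟨b₁, hb₁, b', hb', rfl⟩ := Submodule.mem_sup.mp (hk₂ (mem_ker.mpr hb))
    rw [mem_ker, LinearMap.add_apply] at ha' hb'
    rw [mem_ker] at ha₁ hb₁
    apply add_mem
    · refine hI ⟨⟨_, rfl⟩, ⟨-a', ?_⟩⟩
      rw [map_add, ha₁, zero_add, map_neg]
      exact (eq_neg_of_add_eq_zero_left ha').symm
    · refine hI ⟨⟨-b', ?_⟩, ⟨_, rfl⟩⟩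
      rw [map_add, hb₁, zero_add, map_neg]
      exact (eq_neg_of_add_eq_zero_right hb').symm
  · rintro _ ⟨x, rfl⟩
    refine ⟨⟨?_, ?_⟩, Submodule.mem_sup_left ⟨δ₂ x, rfl⟩⟩
    · exact h1 _
    · rw [SetLike.mem_coe, mem_ker, comp_apply, h12, map_neg, h2, neg_zero]

theorem ker_total_le_of_deldelbar (h1 : ∀ x, δ₁ (δ₁ x) = 0) (h2 : ∀ x, δ₂ (δ₂ x) = 0)
    (h12 : ∀ x, δ₁ (δ₂ x) = -δ₂ (δ₁ x))
    (hL : ker δ₁ ⊓ ker δ₂ ⊓ (range δ₁ ⊔ range δ₂) = range (δ₁ ∘ₗ δ₂)) :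
    ker (δ₁ + δ₂) ≤ (ker δ₁ ⊓ ker δ₂) ⊔ range (δ₁ + δ₂) := by
  intro x hx
  have hx' : δ₂ x = -δ₁ x := eq_neg_of_add_eq_zero_right hx
  have hmem : δ₁ x ∈ ker δ₁ ⊓ ker δ₂ ⊓ (range δ₁ ⊔ range δ₂) := by
    refine ⟨⟨h1 x, ?_⟩, Submodule.mem_sup_left ⟨x, rfl⟩⟩
    rw [SetLike.mem_coe, mem_ker, ← neg_eq_zero, ← h12, hx', map_neg, h1, neg_zero]
  rw [hL] at hmem
  obtain ⟨y, hy⟩ := hmem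
  rw [comp_apply] at hy
  rw [← sub_add_cancel x ((δ₁ + δ₂) y)]
  refine Submodule.add_mem_sup ⟨?_, ?_⟩ ⟨y, rfl⟩
  · simp [h1, hy]
  · have : δ₂ (δ₁ y) = -δ₁ x := by rw [← hy, h12, neg_neg]
    simp [h2, hx', this]

theorem ker_comp_le_of_deldelbar (h1 : ∀ x, δ₁ (δ₁ x) = 0) (h2 : ∀ x, δ₂ (δ₂ x) = 0)
    (h12 : ∀ x, δ₁ (δ₂ x) = -δ₂ (δ₁ x))
    (hL : ker δ₁ ⊓ ker δ₂ ⊓ (range δ₁ ⊔ range δ₂) = range (δ₁ ∘ₗ δ₂)) :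
    ker (δ₁ ∘ₗ δ₂) ≤ ker (δ₁ + δ₂) ⊔ (range δ₁ ⊔ range δ₂) := by
  intro x hx
  rw [mem_ker, comp_apply] at hx
  have hmem : (δ₁ + δ₂) x ∈ ker δ₁ ⊓ ker δ₂ ⊓ (range δ₁ ⊔ range δ₂) := by
    refine ⟨⟨?_, ?_⟩, Submodule.add_mem_sup ⟨x, rfl⟩ ⟨x, rfl⟩⟩
    · simp [h1, hx]
    · have : δ₂ (δ₁ x) = 0 := by rw [← neg_eq_zero, ← h12, hx]
      simp [h2, this]
  rw [hL] at hmem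
  obtain ⟨y, hy⟩ := hmem
  rw [← sub_add_cancel x (δ₂ y)]
  refine Submodule.add_mem_sup ?_ (Submodule.mem_sup_right ⟨y, rfl⟩)
  rw [mem_ker, map_sub, ← hy]
  simp [h2]

theorem ker_total_inf_le_of_deldelbar (h1 : ∀ x, δ₁ (δ₁ x) = 0) (h2 : ∀ x, δ₂ (δ₂ x) = 0)
    (h12 : ∀ x, δ₁ (δ₂ x) = -δ₂ (δ₁ x))
    (hL : ker δ₁ ⊓ ker δ₂ ⊓ (range δ₁ ⊔ range δ₂) = range (δ₁ ∘ₗ δ₂)) :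
    ker (δ₁ + δ₂) ⊓ (range δ₁ ⊔ range δ₂) ≤ range (δ₁ + δ₂) := by
  rintro x ⟨hx, hxI⟩
  obtain ⟨a, ha, b, hb, rfl⟩ := Submodule.mem_sup.mp (ker_total_le_of_deldelbar h1 h2 h12 hL hx)
  refine add_mem ?_ hb
  have hbI : b ∈ range δ₁ ⊔ range δ₂ := range_sup_range_add.le (Submodule.mem_sup_right hb)
  have haL : a ∈ range (δ₁ ∘ₗ δ₂) := hL.le ⟨ha, by simpa using sub_mem hxI hbI⟩
  obtain ⟨y, rfl⟩ := haL
  exact ⟨δ₂ y, by simp [h2]⟩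

end DoubleComplex

theorem deldelbar_lemma_iff_equality
    {K V : Type*} [Field K] [AddCommGroup V] [Module K V]
    (B : ℤ × ℤ → Submodule K V) (hB : DirectSum.IsInternal B)
    (hbounded : {pq : ℤ × ℤ | B pq ≠ ⊥}.Finite)
    (δ₁ δ₂ : V →ₗ[K] V)
    (hd1 : ∀ p q : ℤ, (B (p, q)).map δ₁ ≤ B (p + 1, q))
    (hd2 : ∀ p q : ℤ, (B (p, q)).map δ₂ ≤ B (p, q + 1))
    (h1 : δ₁ ∘ₗ δ₁ = 0) (h2 : δ₂ ∘ₗ δ₂ = 0)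
    (h12 : δ₁ ∘ₗ δ₂ + δ₂ ∘ₗ δ₁ = 0)
    (hfin1 : ∀ p q : ℤ, FiniteDimensional K (SubQuot (ker δ₁ ⊓ B (p, q)) (range δ₁)))
    (hfin2 : ∀ p q : ℤ, FiniteDimensional K (SubQuot (ker δ₂ ⊓ B (p, q)) (range δ₂))) :
    (ker δ₁ ⊓ ker δ₂ ⊓ (range δ₁ ⊔ range δ₂) = range (δ₁ ∘ₗ δ₂)) ↔
    ((∀ p q : ℤ,
        FiniteDimensional K
          (SubQuot (ker δ₁ ⊓ ker δ₂ ⊓ B (p, q)) (range (δ₁ ∘ₗ δ₂))) ∧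
        FiniteDimensional K
          (SubQuot (ker (δ₁ ∘ₗ δ₂) ⊓ B (p, q)) (range δ₁ ⊔ range δ₂))) ∧
      ∀ k : ℤ,
        (∑ᶠ p : ℤ,
          (finrank K (SubQuot (ker δ₁ ⊓ ker δ₂ ⊓ B (p, k - p)) (range (δ₁ ∘ₗ δ₂))) +
           finrank K (SubQuot (ker (δ₁ ∘ₗ δ₂) ⊓ B (p, k - p)) (range δ₁ ⊔ range δ₂)))) =
        2 * finrank K (SubQuot (ker (δ₁ + δ₂) ⊓ TotalPiece B k) (range (δ₁ + δ₂)))) := by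
  have h1' : ∀ x, δ₁ (δ₁ x) = 0 := LinearMap.congr_fun h1
  have h2' : ∀ x, δ₂ (δ₂ x) = 0 := LinearMap.congr_fun h2
  have h12' : ∀ x, δ₁ (δ₂ x) = -δ₂ (δ₁ x) := fun x ↦
    eq_neg_of_add_eq_zero_left (LinearMap.congr_fun h12 x)
  have t₁ : IsHomogOfDegree (gradProj hB fun i ↦ i.1 + i.2) δ₁ 1 :=
    isHomogOfDegree_gradProj hB _ (fun i ↦ (i.1 + 1, i.2)) (fun i ↦ by ring)
      fun i ↦ hd1 i.1 i.2
  have t₂ : IsHomogOfDegree (gradProj hB fun i ↦ i.1 + i.2) δ₂ 1 :=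
    isHomogOfDegree_gradProj hB _ (fun i ↦ (i.1, i.2 + 1)) (fun i ↦ by ring)
      fun i ↦ hd2 i.1 i.2
  have p₁ : IsHomogOfDegree (gradProj hB Prod.fst) δ₁ 1 :=
    isHomogOfDegree_gradProj hB _ (fun i ↦ (i.1 + 1, i.2)) (fun i ↦ rfl) fun i ↦ hd1 i.1 i.2
  have p₂ : IsHomogOfDegree (gradProj hB Prod.fst) δ₂ 0 :=
    isHomogOfDegree_gradProj hB _ (fun i ↦ (i.1, i.2 + 1)) (fun i ↦ (add_zero _).symm)
      fun i ↦ hd2 i.1 i.2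
  have q₁ : IsHomogOfDegree (gradProj hB Prod.snd) δ₁ 0 :=
    isHomogOfDegree_gradProj hB _ (fun i ↦ (i.1 + 1, i.2)) (fun i ↦ (add_zero _).symm)
      fun i ↦ hd1 i.1 i.2
  have q₂ : IsHomogOfDegree (gradProj hB Prod.snd) δ₂ 1 :=
    isHomogOfDegree_gradProj hB _ (fun i ↦ (i.1, i.2 + 1)) (fun i ↦ rfl) fun i ↦ hd2 i.1 i.2
  have td := t₁.add t₂
  have hfin : relLength (ker δ₁) (range δ₁) ≠ ⊤ :=
    relLength_ne_top_of_pieces hB hbounded t₁.ker t₁.range p₁.ker p₁.range hfin1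
  have hle₁ : relLength (ker (δ₁ + δ₂)) (range (δ₁ + δ₂)) ≤ relLength (ker δ₁) (range δ₁) :=
    (isProjFamily_gradProj hB hbounded Prod.snd).relLength_add_le q₁ q₂
      (total_apply_total_apply h1' h2' h12')
  have hle₂ : relLength (ker (δ₁ + δ₂)) (range (δ₁ + δ₂)) ≤ relLength (ker δ₂) (range δ₂) := by
    rw [add_comm δ₁]
    exact (isProjFamily_gradProj hB hbounded Prod.fst).relLength_add_le p₂ p₁
      (total_apply_total_apply h2' h1' fun x ↦ by rw [h12', neg_neg])
  have hfind := ne_top_of_le_ne_top hfin hle₁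
  have hfindk : ∀ k, FiniteDimensional K
      (SubQuot (ker (δ₁ + δ₂) ⊓ TotalPiece B k) (range (δ₁ + δ₂))) := fun k ↦
    (relLength_ne_top_iff _ _).mp <| ne_top_of_le_ne_top hfind <|
      relLength_le_of_map .id (fun x hx ↦ hx.1) fun x _ hx ↦ hx
  have hBC := cast_finsum_finrank_eq hB hbounded (p₁.ker.inf p₂.ker) (p₁.comp p₂).range
    (p₁.comp p₂).ker (p₁.range.sup p₂.range)
  constructor
  · intro hL
    have hdI : range (δ₁ + δ₂) ≤ range δ₁ ⊔ range δ₂ := le_sup_right.trans range_sup_range_add.le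
    have hDd : range (δ₁ ∘ₗ δ₂) ≤ range (δ₁ + δ₂) := by
      rintro _ ⟨x, rfl⟩
      exact ⟨δ₂ x, by simp [h2']⟩
    have hidem := (isProjFamily_gradProj hB hbounded fun i ↦ i.1 + i.2).idem
    have hbc : ∀ k, relLength (ker δ₁ ⊓ ker δ₂ ⊓ TotalPiece B k) (range (δ₁ ∘ₗ δ₂)) =
        relLength (ker (δ₁ + δ₂) ⊓ TotalPiece B k) (range (δ₁ + δ₂)) := by
      intro k
      rw [← range_gradProj_total hB]
      refine relLength_inf_range_eq _ (hidem k) ((t₁.ker.inf t₂.ker) k) (td.range k) hDd ?_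
        (ker_total_le_of_deldelbar h1' h2' h12' hL) (td.ker k) ?_
      · rintro x ⟨hx₁, hx₂⟩
        refine Submodule.mem_sup_left ?_
        rw [mem_ker, LinearMap.add_apply, mem_ker.mp hx₁, mem_ker.mp hx₂, add_zero]
      · exact (inf_le_inf_left _ hdI).trans hL.le
    have hae : ∀ k, relLength (ker (δ₁ ∘ₗ δ₂) ⊓ TotalPiece B k) (range δ₁ ⊔ range δ₂) =
        relLength (ker (δ₁ + δ₂) ⊓ TotalPiece B k) (range (δ₁ + δ₂)) := by
      intro k
      rw [← range_gradProj_total hB]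
      refine (relLength_inf_range_eq _ (hidem k) (td.ker k) ((t₁.range.sup t₂.range) k) hdI ?_
        (ker_comp_le_of_deldelbar h1' h2' h12' hL) ((t₁.comp t₂).ker k)
        (ker_total_inf_le_of_deldelbar h1' h2' h12' hL)).symm
      refine le_trans (fun x hx ↦ ?_) le_sup_left
      rw [mem_ker, comp_apply, eq_neg_of_add_eq_zero_right (mem_ker.mp hx), map_neg, h1', neg_zero]
    have hfinpq : ∀ {M N : Submodule K V},
        (∀ k, relLength (M ⊓ TotalPiece B k) N =
          relLength (ker (δ₁ + δ₂) ⊓ TotalPiece B k) (range (δ₁ + δ₂))) →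
        ∀ p q, FiniteDimensional K (SubQuot (M ⊓ B (p, q)) N) := by
      intro M N h p q
      rw [← relLength_ne_top_iff]
      have hk := (relLength_ne_top_iff _ _).mpr (hfindk (p + q))
      rw [← h] at hk
      have hBT : B (p, q) ≤ TotalPiece B (p + q) := by
        have := le_iSup (fun p' ↦ B (p', p + q - p')) p
        simpa using this
      exact ne_top_of_le_ne_top hk <|
        relLength_le_of_map .id (fun x hx ↦ ⟨hx.1, hBT hx.2⟩) fun x _ hx ↦ hx
    have hfinite := fun p q ↦ And.intro (hfinpq hbc p q) (hfinpq hae p q)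
    refine ⟨hfinite, fun k ↦ ?_⟩
    have := hfindk k
    have hk := hBC hfinite k
    rw [hbc, hae, ← two_mul, relLength_eq_finrank] at hk
    exact_mod_cast hk
  · rintro ⟨hfinite, hsum⟩
    refine deldelbar_lemma_of_relLength_eq h1' h2' h12' hfind hle₁ hle₂ ?_
    rw [relLength_eq_sum_totalPiece hB hbounded (t₁.ker.inf t₂.ker) (t₁.comp t₂).range,
      relLength_eq_sum_totalPiece hB hbounded (t₁.comp t₂).ker (t₁.range.sup t₂.range),
      relLength_eq_sum_totalPiece hB hbounded td.ker td.range, ← Finset.sum_add_distrib,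
      Finset.mul_sum]
    refine Finset.sum_congr rfl fun k _ ↦ ?_
    have := hfindk k
    rw [← hBC hfinite k, hsum k, relLength_eq_finrank]
    norm_cast
end

section
/- Let K be a field and V a K-vector space with linear endomorphisms δ₁, δ₂ : V → V satisfying δ₁² = 0, δ₂² = 0 and δ₁δ₂ + δ₂δ₁ = 0. Suppose that H_{δ₁}, H_{δ₂}, H_BC and H_A are all finite-dimensional. Then dim H_BC + dim H_A = dim H_{δ₁} + dim H_{δ₂} + dim( (im δ₁ ∩ im δ₂)/im(δ₁δ₂) ) + dim( ker(δ₁δ₂)/(ker δ₁ + ker δ₂) ). -/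
open LinearMap Module

namespace SubQuot

variable {K V : Type*} [Field K] [AddCommGroup V] [Module K V]

open Submodule

/-- The rank of subquotients is additive along a chain `N ≤ L ≤ M`. -/
lemma rank_add {N L M : Submodule K V} (hNL : N ≤ L) (hLM : L ≤ M) :
    Module.rank K (SubQuot M N) =
      Module.rank K (SubQuot M L) + Module.rank K (SubQuot L N) := by
  let f : SubQuot L N →ₗ[K] SubQuot M N :=
    mapQ _ _ (inclusion hLM) (fun _ hx => hx)
  let g : SubQuot M N →ₗ[K] SubQuot M L :=
    mapQ _ _ LinearMap.id (fun _ hx => hNL hx)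
  have hf : Function.Injective f := by
    rw [injective_iff_map_eq_zero]
    intro x
    induction x using Submodule.Quotient.induction_on with
    | H x =>
      intro h
      rw [Submodule.Quotient.mk_eq_zero]
      exact (Submodule.Quotient.mk_eq_zero (N.comap M.subtype) (x := inclusion hLM x)).1 h
  have hg : Function.Surjective g := by
    intro y
    induction y using Submodule.Quotient.induction_on with
    | H y => exact ⟨Submodule.Quotient.mk y, rfl⟩
  have hfg : LinearMap.ker g = LinearMap.range f := by
    ext x
    induction x using Submodule.Quotient.induction_on with
    | H x =>
      constructor
      · intro h
        have hx : (x : V) ∈ L := (Submodule.Quotient.mk_eq_zero (L.comap M.subtype)).1 h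
        exact ⟨Submodule.Quotient.mk ⟨x, hx⟩, rfl⟩
      · rintro ⟨y, hy⟩
        rw [← hy]
        induction y using Submodule.Quotient.induction_on with
        | H y => exact (Submodule.Quotient.mk_eq_zero _).2 y.2
  rw [← LinearMap.rank_range_add_rank_ker g, hfg, rank_range_of_surjective g hg,
    ← (LinearEquiv.ofInjective f hf).rank_eq]

/-- Noether's second isomorphism theorem, in terms of ranks. -/
lemma rank_sup (M N : Submodule K V) :
    Module.rank K (SubQuot (M ⊔ N) N) = Module.rank K (SubQuot M (M ⊓ N)) :=
  (LinearMap.quotientInfEquivSupQuotient M N).rank_eq.symm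

/-- For `B₁ ≤ Z₁` and `B₂ ≤ Z₂`, the ranks of the subquotients of the infima and of the
suprema add up to the ranks of `Z₁ / B₁` and `Z₂ / B₂`. -/
lemma rank_inf_add_rank_sup {B₁ Z₁ B₂ Z₂ : Submodule K V} (h₁ : B₁ ≤ Z₁) (h₂ : B₂ ≤ Z₂) :
    Module.rank K (SubQuot (Z₁ ⊓ Z₂) (B₁ ⊓ B₂)) +
        Module.rank K (SubQuot (Z₁ ⊔ Z₂) (B₁ ⊔ B₂)) =
      Module.rank K (SubQuot Z₁ B₁) + Module.rank K (SubQuot Z₂ B₂) := by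
  have hsup : Module.rank K (SubQuot (Z₁ ⊔ Z₂) (B₁ ⊔ B₂)) =
      Module.rank K (SubQuot (Z₁ ⊔ Z₂) (Z₁ ⊔ B₂)) +
        Module.rank K (SubQuot (Z₁ ⊔ B₂) (B₁ ⊔ B₂)) :=
    rank_add (sup_le_sup_right h₁ _) (sup_le_sup_left h₂ _)
  have hinf : Module.rank K (SubQuot (Z₁ ⊓ Z₂) (B₁ ⊓ B₂)) =
      Module.rank K (SubQuot (Z₁ ⊓ Z₂) (Z₁ ⊓ B₂)) +
        Module.rank K (SubQuot (Z₁ ⊓ B₂) (B₁ ⊓ B₂)) :=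
    rank_add (inf_le_inf_right _ h₁) (inf_le_inf_left _ h₂)
  have hZ₁ : Module.rank K (SubQuot Z₁ B₁) =
      Module.rank K (SubQuot Z₁ (Z₁ ⊓ B₂ ⊔ B₁)) +
        Module.rank K (SubQuot (Z₁ ⊓ B₂ ⊔ B₁) B₁) :=
    rank_add le_sup_right (sup_le inf_le_left h₁)
  have hZ₂ : Module.rank K (SubQuot Z₂ B₂) =
      Module.rank K (SubQuot Z₂ (Z₁ ⊓ Z₂ ⊔ B₂)) +
        Module.rank K (SubQuot (Z₁ ⊓ Z₂ ⊔ B₂) B₂) :=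
    rank_add le_sup_right (sup_le inf_le_right h₂)
  have e₁ := rank_sup (Z₁ ⊓ B₂) B₁
  have e₂ := rank_sup (Z₁ ⊓ Z₂) B₂
  have e₃ := rank_sup Z₁ (B₁ ⊔ B₂)
  have e₄ := rank_sup Z₂ (Z₁ ⊔ B₂)
  rw [show Z₁ ⊓ B₂ ⊓ B₁ = B₁ ⊓ B₂ by
    rw [inf_right_comm, inf_eq_right.2 h₁]] at e₁
  rw [show Z₁ ⊓ Z₂ ⊓ B₂ = Z₁ ⊓ B₂ by
    rw [inf_assoc, inf_eq_right.2 h₂]] at e₂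
  rw [show Z₁ ⊔ (B₁ ⊔ B₂) = Z₁ ⊔ B₂ by rw [← sup_assoc, sup_eq_left.2 h₁],
    show Z₁ ⊓ (B₁ ⊔ B₂) = Z₁ ⊓ B₂ ⊔ B₁ by
      rw [inf_comm, sup_inf_assoc_of_le B₂ h₁, sup_comm, inf_comm B₂]] at e₃
  rw [show Z₂ ⊔ (Z₁ ⊔ B₂) = Z₁ ⊔ Z₂ by
      rw [sup_left_comm, sup_eq_left.2 h₂],
    show Z₂ ⊓ (Z₁ ⊔ B₂) = Z₁ ⊓ Z₂ ⊔ B₂ by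
      rw [inf_comm, sup_comm, sup_inf_assoc_of_le Z₁ h₂, sup_comm]] at e₄
  rw [hsup, hinf, hZ₁, hZ₂, e₁, e₂, e₃, e₄]
  ac_rfl

end SubQuot

theorem dim_BC_add_dim_A_eq
    {K V : Type*} [Field K] [AddCommGroup V] [Module K V]
    (δ₁ δ₂ : V →ₗ[K] V)
    (h1 : δ₁ ∘ₗ δ₁ = 0) (h2 : δ₂ ∘ₗ δ₂ = 0)
    (h12 : δ₁ ∘ₗ δ₂ + δ₂ ∘ₗ δ₁ = 0)
    (hfin1 : FiniteDimensional K (SubQuot (ker δ₁) (range δ₁)))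
    (hfin2 : FiniteDimensional K (SubQuot (ker δ₂) (range δ₂)))
    (hfinBC : FiniteDimensional K (SubQuot (ker δ₁ ⊓ ker δ₂) (range (δ₁ ∘ₗ δ₂))))
    (hfinA : FiniteDimensional K (SubQuot (ker (δ₁ ∘ₗ δ₂)) (range δ₁ ⊔ range δ₂))) :
    finrank K (SubQuot (ker δ₁ ⊓ ker δ₂) (range (δ₁ ∘ₗ δ₂))) +
      finrank K (SubQuot (ker (δ₁ ∘ₗ δ₂)) (range δ₁ ⊔ range δ₂)) =
    finrank K (SubQuot (ker δ₁) (range δ₁)) +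
      finrank K (SubQuot (ker δ₂) (range δ₂)) +
      finrank K (SubQuot (range δ₁ ⊓ range δ₂) (range (δ₁ ∘ₗ δ₂))) +
      finrank K (SubQuot (ker (δ₁ ∘ₗ δ₂)) (ker δ₁ ⊔ ker δ₂)) := by
  have h21 (x : V) : δ₁ (δ₂ x) = -δ₂ (δ₁ x) :=
    eq_neg_of_add_eq_zero_left (LinearMap.congr_fun h12 x)
  have hB₁ : range δ₁ ≤ ker δ₁ := range_le_ker_iff.2 h1
  have hB₂ : range δ₂ ≤ ker δ₂ := range_le_ker_iff.2 h2
  have hD : range (δ₁ ∘ₗ δ₂) ≤ range δ₁ ⊓ range δ₂ := by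
    rintro _ ⟨x, rfl⟩
    exact ⟨⟨δ₂ x, rfl⟩, ⟨-δ₁ x, by simp [h21]⟩⟩
  have hP : ker δ₁ ⊔ ker δ₂ ≤ ker (δ₁ ∘ₗ δ₂) := by
    refine sup_le (fun x hx => ?_) (fun x hx => ?_)
    · rw [mem_ker] at hx
      simp [h21, hx]
    · rw [mem_ker] at hx
      simp [hx]
  have hBC := SubQuot.rank_add hD (inf_le_inf hB₁ hB₂)
  have hA := SubQuot.rank_add (sup_le_sup hB₁ hB₂) hP
  have hZ := SubQuot.rank_inf_add_rank_sup hB₁ hB₂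
  have hBC_lt := rank_lt_aleph0 K (SubQuot (ker δ₁ ⊓ ker δ₂) (range (δ₁ ∘ₗ δ₂)))
  have hA_lt := rank_lt_aleph0 K (SubQuot (ker (δ₁ ∘ₗ δ₂)) (range δ₁ ⊔ range δ₂))
  rw [hBC, Cardinal.add_lt_aleph0_iff] at hBC_lt
  rw [hA, Cardinal.add_lt_aleph0_iff] at hA_lt
  have hBC' := congrArg Cardinal.toNat hBC
  have hA' := congrArg Cardinal.toNat hA
  have hZ' := congrArg Cardinal.toNat hZ
  rw [Cardinal.toNat_add hBC_lt.1 hBC_lt.2] at hBC'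
  rw [Cardinal.toNat_add hA_lt.1 hA_lt.2] at hA'
  rw [Cardinal.toNat_add hBC_lt.1 hA_lt.2,
    Cardinal.toNat_add (rank_lt_aleph0 K _) (rank_lt_aleph0 K _)] at hZ'
  simp only [finrank]
  omega
end
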